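/- arXiv:2304.05005 — 6 statements merged into one kernel-verified Lean document; each statement's English description precedes it below -/
import Mathlib

section
/- Let Θ and A be finite nonempty sets, ρ ∈ Δ(Θ), T ≥ 1, decisions π^t ∈ Δ(A)^Θ and reward vectors u^t ∈ [0,1]^{Θ×A} for t = 1,…,T. Set x^t(θ,a) = π^t(θ;a) and ū^t(θ,a) = ρ(θ)·u^t(θ,a). Then the untruthful swap regret R_US of the decisions equals sup_{Q∈𝒬} ∑_{t=1}^T ⟨Q x^t, ū^t⟩ − ∑_{t=1}^T ⟨x^t, ū^t⟩, where (Qx)(θ,a) = ∑_{θ',a'} Q((θ,a),(θ',a'))·x(θ',a'). -/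
open Finset
open scoped Classical

noncomputable section

/-- `f` is a probability distribution on the finite set `X`. -/
def IsDist {X : Type*} [Fintype X] (f : X → ℝ) : Prop :=
  (∀ x, f x ∈ Set.Icc (0 : ℝ) 1) ∧ ∑ x, f x = 1

variable {Θ A : Type*} [Fintype Θ] [Nonempty Θ] [Fintype A] [Nonempty A]

/-- The untruthful swap regret of decisions `π` against rewards `u` with prior `ρ`. -/
def untruthfulSwapRegret (ρ : Θ → ℝ) (T : ℕ)
    (π : Fin T → Θ → A → ℝ) (u : Fin T → Θ → A → ℝ) : ℝ :=
  ⨆ ψ : Θ → Θ, ⨆ φ : Θ → A → A,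
    ∑ t, ∑ θ, ρ θ *
      ((∑ a, π t (ψ θ) a * u t θ (φ θ a)) - ∑ a, π t θ a * u t θ a)

/-- The set `𝒬` of transformations. -/
def QSet (Θ A : Type*) [Fintype Θ] [Fintype A] : Set (Θ × A → Θ × A → ℝ) :=
  {Q | (∀ p q, Q p q ∈ Set.Icc (0 : ℝ) 1) ∧
    ∃ W : Θ → Θ → ℝ, (∀ θ θ', W θ θ' ∈ Set.Icc (0 : ℝ) 1) ∧
      (∀ θ, ∑ θ', W θ θ' = 1) ∧
      ∀ θ θ' a', ∑ a, Q (θ, a) (θ', a') = W θ θ'}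

/-- The transformation that reports `ψ θ` instead of `θ` and plays `φ θ a` when told `a`. -/
def pureTransformation (ψ : Θ → Θ) (φ : Θ → A → A) : Θ × A → Θ × A → ℝ :=
  fun p q => if q.1 = ψ p.1 ∧ p.2 = φ p.1 q.2 then 1 else 0

theorem pureTransformation_mem_QSet {Θ A : Type*} [Fintype Θ] [Fintype A]
    (ψ : Θ → Θ) (φ : Θ → A → A) : pureTransformation ψ φ ∈ QSet Θ A := by
  refine ⟨fun p q => ?_, fun θ θ' => if θ' = ψ θ then 1 else 0, fun θ θ' => ?_, fun θ => ?_,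
    fun θ θ' a' => ?_⟩
  · unfold pureTransformation; split_ifs <;> simp
  · dsimp only; split_ifs <;> simp
  · simp
  · by_cases h : θ' = ψ θ <;> simp [pureTransformation, h]

theorem sum_pureTransformation_mul {Θ A : Type*} [Fintype Θ] [Fintype A]
    (ψ : Θ → Θ) (φ : Θ → A → A) (c : Θ × A → Θ × A → ℝ) :
    ∑ p, ∑ q, pureTransformation ψ φ p q * c p q = ∑ θ, ∑ a, c (θ, φ θ a) (ψ θ, a) := by
  simp only [pureTransformation, Fintype.sum_prod_type, ite_and, ite_mul, one_mul, zero_mul]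
  refine sum_congr rfl fun θ _ => ?_
  have h (a : A) : (∑ θ', ∑ a', if θ' = ψ θ then
      if a = φ θ a' then c (θ, a) (θ', a') else 0 else 0)
      = ∑ a', if a = φ θ a' then c (θ, a) (ψ θ, a') else 0 := by
    rw [sum_comm]
    simp
  simp only [h]
  rw [sum_comm]
  simp

/-- A linear functional on `𝒬` is dominated by its value at some pure transformation. -/
theorem exists_pure_dominating {Θ A : Type*} [Fintype Θ] [Nonempty Θ] [Fintype A] [Nonempty A]
    (c : Θ × A → Θ × A → ℝ) :
    ∃ (ψ : Θ → Θ) (φ : Θ → A → A), ∀ Q ∈ QSet Θ A,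
      ∑ p, ∑ q, Q p q * c p q ≤ ∑ θ, ∑ a, c (θ, φ θ a) (ψ θ, a) := by
  choose best hbest using fun (θ θ' : Θ) (a' : A) =>
    Finite.exists_max fun a => c (θ, a) (θ', a')
  choose ψ hψ using fun θ : Θ =>
    Finite.exists_max fun θ' => ∑ a', c (θ, best θ θ' a') (θ', a')
  refine ⟨ψ, fun θ => best θ (ψ θ), ?_⟩
  rintro Q ⟨hQ, W, hW, hW1, hQW⟩
  rw [Fintype.sum_prod_type]
  refine sum_le_sum fun θ _ => ?_
  calc ∑ a, ∑ q, Q (θ, a) q * c (θ, a) q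
      ≤ ∑ a, ∑ q : Θ × A, Q (θ, a) q * c (θ, best θ q.1 q.2) q :=
        sum_le_sum fun a _ => sum_le_sum fun q _ =>
          mul_le_mul_of_nonneg_left (hbest θ q.1 q.2 a) (hQ _ _).1
    _ = ∑ θ', W θ θ' * ∑ a', c (θ, best θ θ' a') (θ', a') := by
        rw [sum_comm, Fintype.sum_prod_type]
        simp only [← sum_mul, hQW, mul_sum]
    _ ≤ ∑ θ', W θ θ' * ∑ a', c (θ, best θ (ψ θ) a') (ψ θ, a') :=
        sum_le_sum fun θ' _ => mul_le_mul_of_nonneg_left (hψ θ θ') (hW _ _).1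
    _ = _ := by rw [← sum_mul, hW1, one_mul]

/-- The untruthful swap regret equals the `Φ`-regret for the transformation set `𝒬`. -/
theorem untruthfulSwapRegret_eq_Phi_regret
    (ρ : Θ → ℝ) (hρ : IsDist ρ) (T : ℕ) (hT : 1 ≤ T)
    (π : Fin T → Θ → A → ℝ) (hπ : ∀ t θ, IsDist (π t θ))
    (u : Fin T → Θ → A → ℝ) (hu : ∀ t θ a, u t θ a ∈ Set.Icc (0 : ℝ) 1) :
    untruthfulSwapRegret ρ T π u =
      (⨆ Q : QSet Θ A,
        ∑ t, ∑ p : Θ × A,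
          (∑ q : Θ × A, Q.1 p q * π t q.1 q.2) * (ρ p.1 * u t p.1 p.2)) -
      ∑ t, ∑ p : Θ × A, π t p.1 p.2 * (ρ p.1 * u t p.1 p.2) := by
  set c : Θ × A → Θ × A → ℝ := fun p q => ∑ t, π t q.1 q.2 * (ρ p.1 * u t p.1 p.2) with hc
  set B := ∑ t, ∑ p : Θ × A, π t p.1 p.2 * (ρ p.1 * u t p.1 p.2) with hB
  have hV (Q : Θ × A → Θ × A → ℝ) :
      ∑ t, ∑ p : Θ × A, (∑ q : Θ × A, Q p q * π t q.1 q.2) * (ρ p.1 * u t p.1 p.2)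
        = ∑ p, ∑ q, Q p q * c p q := by
    rw [sum_comm]
    refine sum_congr rfl fun p _ => ?_
    simp only [hc, sum_mul, mul_sum]
    rw [sum_comm]
    simp only [mul_assoc]
  have hF (ψ : Θ → Θ) (φ : Θ → A → A) :
      ∑ t, ∑ θ, ρ θ * ((∑ a, π t (ψ θ) a * u t θ (φ θ a)) - ∑ a, π t θ a * u t θ a)
        = ∑ θ, ∑ a, c (θ, φ θ a) (ψ θ, a) - B := by
    simp only [hc, hB, mul_sub, sum_sub_distrib, mul_sum, Fintype.sum_prod_type]
    congr 1
    · rw [sum_comm]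
      refine sum_congr rfl fun θ _ => ?_
      rw [sum_comm]
      simp only [mul_left_comm]
    · simp only [mul_left_comm]
  simp only [untruthfulSwapRegret, hV, hF]
  obtain ⟨ψ, φ, hmax⟩ := exists_pure_dominating c
  have : Nonempty (QSet Θ A) := ⟨⟨_, pureTransformation_mem_QSet ψ φ⟩⟩
  apply le_antisymm
  · refine ciSup_le fun ψ' => ciSup_le fun φ' => sub_le_sub_right ?_ B
    rw [← sum_pureTransformation_mul]
    exact le_ciSup (f := fun Q : QSet Θ A => ∑ p, ∑ q, Q.1 p q * c p q)
      ⟨_, Set.forall_mem_range.2 fun Q => hmax Q.1 Q.2⟩ ⟨_, pureTransformation_mem_QSet ψ' φ'⟩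
  · have hsup : (⨆ Q : QSet Θ A, ∑ p, ∑ q, Q.1 p q * c p q) ≤
        ∑ θ, ∑ a, c (θ, φ θ a) (ψ θ, a) :=
      ciSup_le fun Q => hmax Q.1 Q.2
    refine (sub_le_sub_right hsup B).trans ?_
    let R : (Θ → Θ) → (Θ → A → A) → ℝ := fun ψ' φ' => ∑ θ, ∑ a, c (θ, φ' θ a) (ψ' θ, a) - B
    change R ψ φ ≤ ⨆ ψ', ⨆ φ', R ψ' φ'
    clear_value R
    exact (le_ciSup (Set.finite_range (R ψ)).bddAbove φ).trans
      (le_ciSup (f := fun ψ' => ⨆ φ', R ψ' φ') (Set.finite_range _).bddAbove ψ)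
end
end

section
/- Let Θ and A be finite nonempty sets, ρ ∈ Δ(Θ), T ≥ 1, and reward vectors u^t ∈ [0,1]^{Θ×A} for t = 1,…,T; set ū^t(θ,a) = ρ(θ)·u^t(θ,a). Suppose that for each t we are given Q^t ∈ 𝒬 and x^t ∈ 𝒳 with Q^t x^t = x^t, and define U^t ∈ [0,1]^{(Θ×A)×(Θ×A)} by U^t((θ,a),(θ',a')) = ū^t(θ,a)·x^t(θ',a'). Then the untruthful swap regret R_US of the decisions π^t defined by π^t(θ;a) = x^t(θ,a) (with respect to rewards u^t and prior ρ) equals R_𝒬 = sup_{Q∈𝒬} ∑_{t=1}^T ⟨Q, U^t⟩ − ∑_{t=1}^T ⟨Q^t, U^t⟩. -/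
open Finset
open scoped Classical

noncomputable section

variable {Θ A : Type*} [Fintype Θ] [Nonempty Θ] [Fintype A] [Nonempty A]

/-- The set `𝒳` of type-wise action distributions, as vectors. -/
def XSet (Θ A : Type*) [Fintype A] : Set (Θ × A → ℝ) :=
  {x | (∀ p, x p ∈ Set.Icc (0 : ℝ) 1) ∧ ∀ θ, ∑ a, x (θ, a) = 1}

/-- The deterministic transformation given by a type deviation `ψ` and an action deviation `φ`. -/
def deviationMatrix (ψ : Θ → Θ) (φ : Θ → A → A) : Θ × A → Θ × A → ℝ :=
  fun p q => if q.1 = ψ p.1 then (if p.2 = φ p.1 q.2 then 1 else 0) else 0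

omit [Nonempty Θ] [Nonempty A] in
theorem deviationMatrix_mem_QSet (ψ : Θ → Θ) (φ : Θ → A → A) :
    deviationMatrix ψ φ ∈ QSet Θ A := by
  refine ⟨fun p q => ?_, fun θ θ' => if θ' = ψ θ then 1 else 0, fun θ θ' => ?_, fun θ => ?_,
    fun θ θ' a' => ?_⟩
  · unfold deviationMatrix
    split_ifs <;> simp
  · dsimp only
    split_ifs <;> simp
  · simp
  · unfold deviationMatrix
    by_cases h : θ' = ψ θ <;> simp [h]

omit [Nonempty Θ] [Nonempty A] in
theorem sum_deviationMatrix_mul (ψ : Θ → Θ) (φ : Θ → A → A) (c : Θ × A → Θ × A → ℝ) :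
    ∑ p, ∑ q, deviationMatrix ψ φ p q * c p q =
      ∑ θ, ∑ a', c (θ, φ θ a') (ψ θ, a') := by
  simp only [deviationMatrix, Fintype.sum_prod_type]
  refine Finset.sum_congr rfl fun θ _ => ?_
  have h : ∀ a, ∑ θ', ∑ a', (if θ' = ψ θ then (if a = φ θ a' then (1 : ℝ) else 0) else 0) *
      c (θ, a) (θ', a') = ∑ a', if a = φ θ a' then c (θ, a) (ψ θ, a') else 0 := by
    intro a
    rw [Finset.sum_eq_single (ψ θ)]
    · simp
    · intro b _ hb
      simp [hb]
    · simp
  rw [Finset.sum_congr rfl fun a _ => h a, Finset.sum_comm]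
  simp

/-- A linear functional on `𝒬` is dominated by its value at some deterministic transformation. -/
theorem exists_sum_mul_le_deviation (c : Θ × A → Θ × A → ℝ) :
    ∃ (ψ : Θ → Θ) (φ : Θ → A → A), ∀ Q ∈ QSet Θ A,
      ∑ p, ∑ q, Q p q * c p q ≤ ∑ θ, ∑ a', c (θ, φ θ a') (ψ θ, a') := by
  have hm : ∀ θ θ' a', ∃ m : A, ∀ a, c (θ, a) (θ', a') ≤ c (θ, m) (θ', a') :=
    fun θ θ' a' => Finite.exists_max fun a => c (θ, a) (θ', a')
  choose m hm using hm
  have hψ : ∀ θ, ∃ s : Θ, ∀ θ', ∑ a', c (θ, m θ θ' a') (θ', a') ≤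
      ∑ a', c (θ, m θ s a') (s, a') :=
    fun θ => Finite.exists_max fun θ' => ∑ a', c (θ, m θ θ' a') (θ', a')
  choose ψ hψ using hψ
  refine ⟨ψ, fun θ => m θ (ψ θ), ?_⟩
  rintro Q ⟨hQ, W, hW, hW1, hQW⟩
  simp only [Fintype.sum_prod_type]
  refine Finset.sum_le_sum fun θ _ => ?_
  calc ∑ a, ∑ θ', ∑ a', Q (θ, a) (θ', a') * c (θ, a) (θ', a')
      = ∑ θ', ∑ a', ∑ a, Q (θ, a) (θ', a') * c (θ, a) (θ', a') := by
        rw [Finset.sum_comm]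
        exact Finset.sum_congr rfl fun θ' _ => Finset.sum_comm
    _ ≤ ∑ θ', ∑ a', ∑ a, Q (θ, a) (θ', a') * c (θ, m θ θ' a') (θ', a') := by
        gcongr with θ' _ a' _ a _
        · exact (hQ _ _).1
        · exact hm θ θ' a' a
    _ = ∑ θ', W θ θ' * ∑ a', c (θ, m θ θ' a') (θ', a') := by
        simp only [← Finset.sum_mul, hQW, Finset.mul_sum]
    _ ≤ ∑ θ', W θ θ' * ∑ a', c (θ, m θ (ψ θ) a') (ψ θ, a') := by
        exact Finset.sum_le_sum fun θ' _ => mul_le_mul_of_nonneg_left (hψ θ θ') (hW θ θ').1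
    _ = ∑ a', c (θ, m θ (ψ θ) a') (ψ θ, a') := by
        rw [← Finset.sum_mul, hW1, one_mul]

/-- The supremum of a linear functional over `𝒬` is attained at deterministic transformations. -/
theorem iSup_QSet_eq_iSup_deviation (c : Θ × A → Θ × A → ℝ) :
    ⨆ Q : QSet Θ A, ∑ p, ∑ q, Q.1 p q * c p q =
      ⨆ ψ : Θ → Θ, ⨆ φ : Θ → A → A, ∑ θ, ∑ a', c (θ, φ θ a') (ψ θ, a') := by
  obtain ⟨ψ₀, φ₀, h₀⟩ := exists_sum_mul_le_deviation c
  have hne : Nonempty (QSet Θ A) := ⟨⟨_, deviationMatrix_mem_QSet ψ₀ φ₀⟩⟩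
  apply le_antisymm
  · refine ciSup_le fun Q => (h₀ Q.1 Q.2).trans ?_
    refine le_ciSup_of_le (Set.finite_range _).bddAbove ψ₀ ?_
    exact le_ciSup_of_le (Set.finite_range _).bddAbove φ₀ le_rfl
  · refine ciSup_le fun ψ => ciSup_le fun φ => ?_
    rw [← sum_deviationMatrix_mul]
    exact le_ciSup (f := fun Q : QSet Θ A => ∑ p, ∑ q, Q.1 p q * c p q)
      ⟨_, by rintro _ ⟨Q, rfl⟩; exact h₀ Q.1 Q.2⟩ ⟨_, deviationMatrix_mem_QSet ψ φ⟩

/-- If `x^t` is a fixed point of `Q^t ∈ 𝒬` for each round, then the untruthful swap regret of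
the decisions given by `x^t` equals the external regret of the online linear optimization
problem over `𝒬` with rewards `U^t = ū^t (x^t)^⊤`. -/
theorem untruthfulSwapRegret_eq_linear_regret
    (ρ : Θ → ℝ) (hρ : IsDist ρ) (T : ℕ) (hT : 1 ≤ T)
    (u : Fin T → Θ → A → ℝ) (hu : ∀ t θ a, u t θ a ∈ Set.Icc (0 : ℝ) 1)
    (Q : Fin T → Θ × A → Θ × A → ℝ) (hQ : ∀ t, Q t ∈ QSet Θ A)
    (x : Fin T → Θ × A → ℝ) (hx : ∀ t, x t ∈ XSet Θ A)
    (hfix : ∀ t, (fun p => ∑ q, Q t p q * x t q) = x t) :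
    untruthfulSwapRegret ρ T (fun t θ a => x t (θ, a)) u =
      (⨆ Q' : QSet Θ A,
        ∑ t, ∑ p : Θ × A, ∑ q : Θ × A,
          Q'.1 p q * ((ρ p.1 * u t p.1 p.2) * x t q)) -
      ∑ t, ∑ p : Θ × A, ∑ q : Θ × A,
        Q t p q * ((ρ p.1 * u t p.1 p.2) * x t q) := by
  have hlin : ∀ Q' : QSet Θ A, ∑ t, ∑ p : Θ × A, ∑ q : Θ × A,
      Q'.1 p q * ((ρ p.1 * u t p.1 p.2) * x t q) =
      ∑ p : Θ × A, ∑ q : Θ × A, Q'.1 p q * ∑ t, (ρ p.1 * u t p.1 p.2) * x t q := by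
    intro Q'
    rw [Finset.sum_comm]
    refine Finset.sum_congr rfl fun p _ => ?_
    rw [Finset.sum_comm]
    exact Finset.sum_congr rfl fun q _ => (Finset.mul_sum _ _ _).symm
  have hbase : ∑ t, ∑ p : Θ × A, ∑ q : Θ × A,
      Q t p q * ((ρ p.1 * u t p.1 p.2) * x t q) =
      ∑ t, ∑ θ, ρ θ * ∑ a, x t (θ, a) * u t θ a := by
    refine Finset.sum_congr rfl fun t _ => ?_
    rw [Fintype.sum_prod_type]
    refine Finset.sum_congr rfl fun θ _ => ?_
    rw [Finset.mul_sum]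
    refine Finset.sum_congr rfl fun a _ => ?_
    have h := congrFun (hfix t) (θ, a)
    rw [← h, Finset.sum_mul, Finset.mul_sum]
    exact Finset.sum_congr rfl fun q _ => by ring
  have hdev : ∀ (ψ : Θ → Θ) (φ : Θ → A → A),
      ∑ θ, ∑ a', ∑ t, (ρ θ * u t θ (φ θ a')) * x t (ψ θ, a') =
      ∑ t, ∑ θ, ρ θ * ∑ a, x t (ψ θ, a) * u t θ (φ θ a) := by
    intro ψ φ
    rw [Finset.sum_comm (s := (Finset.univ : Finset (Fin T)))]
    refine Finset.sum_congr rfl fun θ _ => ?_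
    rw [Finset.sum_comm]
    refine Finset.sum_congr rfl fun t _ => ?_
    rw [Finset.mul_sum]
    exact Finset.sum_congr rfl fun a _ => by ring
  rw [iSup_congr hlin, hbase,
    iSup_QSet_eq_iSup_deviation fun p q => ∑ t, (ρ p.1 * u t p.1 p.2) * x t q]
  simp only [untruthfulSwapRegret, hdev, mul_sub, Finset.sum_sub_distrib]
  rw [ciSup_sub (Set.finite_range _).bddAbove]
  exact iSup_congr fun ψ => (ciSup_sub (Set.finite_range _).bddAbove _).symm
end
end

section
/- For all finite nonempty sets Θ and A, every ρ ∈ Δ(Θ), and every horizon T ≥ 1, there exists an online algorithm—a family of functions F^t : ([0,1]^{Θ×A})^{t−1} → Δ(A)^Θ for t = 1,…,T—such that for every sequence of reward vectors u^1,…,u^T ∈ [0,1]^{Θ×A}, the decisions π^t = F^t(u^1,…,u^{t−1}) have untruthful swap regret R_US ≤ √((1/2)·T·log|Θ|) + 6·√(T·|A|·log|A|) + 2·|A|·log|A|, where log denotes the natural logarithm. -/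
open Finset
open scoped Classical

noncomputable section

variable {Θ A : Type*} [Fintype Θ] [Nonempty Θ] [Fintype A] [Nonempty A]

/-- A continuous linear map preserving a nonempty compact convex set has a fixed point there. -/
theorem exists_fixedPoint_of_mapsTo_compact_convex {E : Type*} [NormedAddCommGroup E]
    [NormedSpace ℝ E] {K : Set E} (hK : IsCompact K) (hconv : Convex ℝ K) (hne : K.Nonempty)
    (L : E →L[ℝ] E) (hL : Set.MapsTo L K K) : ∃ x ∈ K, L x = x := by
  obtain ⟨x₀, hx₀⟩ := hne
  have horbit (k : ℕ) : L^[k] x₀ ∈ K := hL.iterate k hx₀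
  have havg (n : ℕ) : birkhoffAverage ℝ L id (n + 1) x₀ ∈ K := by
    rw [birkhoffAverage, birkhoffSum, Finset.smul_sum]
    refine hconv.sum_mem (fun _ _ => by positivity) ?_ (fun k _ => horbit k)
    rw [Finset.sum_const, Finset.card_range, nsmul_eq_mul]
    exact mul_inv_cancel₀ (by positivity)
  obtain ⟨x, hx, e, he, hlim⟩ := hK.tendsto_subseq havg
  refine ⟨x, hx, ?_⟩
  have hbdd : Bornology.IsBounded (Set.range fun k => id (L^[k] x₀)) :=
    hK.isBounded.subset (Set.range_subset_iff.2 horbit)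
  have hzero := ((tendsto_birkhoffAverage_apply_sub_birkhoffAverage ℝ hbdd).comp
    (Filter.tendsto_add_atTop_nat 1)).comp he.tendsto_atTop
  have hmap (n : ℕ) : birkhoffAverage ℝ L id n (L x₀) = L (birkhoffAverage ℝ L id n x₀) := by
    rw [map_birkhoffAverage ℝ ℝ L]
    simp [birkhoffAverage, birkhoffSum, ← Function.iterate_succ_apply,
      Function.iterate_succ_apply']
  have hdiff := ((L.continuous.tendsto x).comp hlim).sub hlim
  refine sub_eq_zero.1 (tendsto_nhds_unique hdiff (hzero.congr fun n => ?_))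
  simp [hmap]

/-- Hoeffding's lemma for a finitely supported distribution on `[0, 1]`. -/
theorem sum_mul_exp_le_of_mem_Icc {I : Type*} [Fintype I] {w g : I → ℝ} (hw : w ∈ stdSimplex ℝ I)
    (hg : ∀ i, g i ∈ Set.Icc (0 : ℝ) 1) (η : ℝ) :
    ∑ i, w i * Real.exp (η * g i) ≤ Real.exp (η * ∑ i, w i * g i + η ^ 2 / 8) := by
  let _ : MeasurableSpace I := ⊤
  let p : PMF I := PMF.ofFintype (fun i => ENNReal.ofReal (w i)) (by
    rw [← ENNReal.ofReal_sum_of_nonneg fun i _ => hw.1 i, hw.2, ENNReal.ofReal_one])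
  have hp (i : I) : (p i).toReal = w i := by simp [p, hw.1 i]
  have h := (ProbabilityTheory.hasSubgaussianMGF_of_mem_Icc (μ := p.toMeasure) (X := g)
    (measurable_of_finite g).aemeasurable (Filter.Eventually.of_forall hg)).mgf_le η
  simp only [ProbabilityTheory.mgf, PMF.integral_eq_sum, hp, smul_eq_mul] at h
  set m := ∑ i, w i * g i
  calc ∑ i, w i * Real.exp (η * g i)
      = Real.exp (η * m) * ∑ i, w i * Real.exp (η * (g i - m)) := by
        rw [Finset.mul_sum]
        refine Finset.sum_congr rfl fun i _ => ?_
        rw [mul_left_comm, ← Real.exp_add]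
        congr 2
        ring
    _ ≤ Real.exp (η * m) * Real.exp (η ^ 2 / 8) := by
        refine mul_le_mul_of_nonneg_left (h.trans_eq ?_) (Real.exp_pos _).le
        congr 1
        norm_num
        ring
    _ = _ := (Real.exp_add _ _).symm

/-- The exponential weights of the score vector `S`. -/
def softmax {I : Type*} [Fintype I] (S : I → ℝ) (i : I) : ℝ :=
  Real.exp (S i) / ∑ j, Real.exp (S j)

theorem softmax_mem_stdSimplex {I : Type*} [Fintype I] [Nonempty I] (S : I → ℝ) :
    softmax S ∈ stdSimplex ℝ I := by
  have hpos : 0 < ∑ j, Real.exp (S j) :=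
    Finset.sum_pos (fun j _ => Real.exp_pos _) Finset.univ_nonempty
  refine ⟨fun i => div_nonneg (Real.exp_pos _).le hpos.le, ?_⟩
  simp only [softmax]
  rw [← Finset.sum_div, div_self hpos.ne']

/-- The regret of the exponential weights algorithm with learning rate `η`. -/
theorem exponentialWeights_regret {I : Type*} [Fintype I] [Nonempty I] (η : ℝ)
    {g : ℕ → I → ℝ} (hg : ∀ k i, g k i ∈ Set.Icc (0 : ℝ) 1) (T : ℕ) (i : I) :
    η * ∑ k ∈ range T, g k i ≤
      η * (∑ k ∈ range T, ∑ j, softmax (fun i => η * ∑ s ∈ range k, g s i) j * g k j) +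
        Real.log (Fintype.card I) + T * (η ^ 2 / 8) := by
  have key (n : ℕ) : ∑ j, Real.exp (η * ∑ k ∈ range n, g k j) ≤
      Real.exp (η * (∑ k ∈ range n, ∑ j, softmax (fun i => η * ∑ s ∈ range k, g s i) j * g k j) +
        Real.log (Fintype.card I) + n * (η ^ 2 / 8)) := by
    induction n with
    | zero => simp [Real.exp_log (Nat.cast_pos.2 Fintype.card_pos : (0 : ℝ) < Fintype.card I)]
    | succ n ih =>
      set S : I → ℝ := fun i => η * ∑ s ∈ range n, g s i
      have hpos : 0 < ∑ j, Real.exp (S j) :=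
        Finset.sum_pos (fun j _ => Real.exp_pos _) Finset.univ_nonempty
      calc ∑ j, Real.exp (η * ∑ k ∈ range (n + 1), g k j)
          = (∑ j, Real.exp (S j)) * ∑ j, softmax S j * Real.exp (η * g n j) := by
            rw [Finset.mul_sum]
            refine Finset.sum_congr rfl fun j _ => ?_
            rw [Finset.sum_range_succ, mul_add, Real.exp_add, softmax]
            field_simp
            rfl
        _ ≤ _ := mul_le_mul ih
            (sum_mul_exp_le_of_mem_Icc (softmax_mem_stdSimplex S) (hg n) η)
            (Finset.sum_nonneg fun j _ => mul_nonneg ((softmax_mem_stdSimplex S).1 j)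
              (Real.exp_pos _).le) (Real.exp_pos _).le
        _ = _ := by
            rw [← Real.exp_add, Finset.sum_range_succ]
            congr 1
            push_cast
            ring
  exact Real.exp_le_exp.1 ((Finset.single_le_sum
    (f := fun j => Real.exp (η * ∑ k ∈ range T, g k j))
    (fun j _ => (Real.exp_pos _).le) (Finset.mem_univ i)).trans (key T))

/-- The learning rate of exponential weights over the index set `I` for the horizon `T`. -/
def learningRate (I : Type*) [Fintype I] (T : ℕ) : ℝ :=
  Real.sqrt (8 * Real.log (Fintype.card I) / T)

theorem exponentialWeights_regret_le_sqrt {I : Type*} [Fintype I] [Nonempty I] {T : ℕ}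
    (hT : 1 ≤ T) {g : ℕ → I → ℝ} (hg : ∀ k i, g k i ∈ Set.Icc (0 : ℝ) 1) (i : I) :
    ∑ k ∈ range T, g k i -
      ∑ k ∈ range T, ∑ j, softmax (fun i => learningRate I T * ∑ s ∈ range k, g s i) j * g k j ≤
        Real.sqrt (1 / 2 * T * Real.log (Fintype.card I)) := by
  rcases subsingleton_or_nontrivial I with hI | hI
  · have hsum (k : ℕ) :
        ∑ j, softmax (fun i => learningRate I T * ∑ s ∈ range k, g s i) j * g k j = g k i := by
      simp_rw [fun j => congrArg (g k) (Subsingleton.elim j i)]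
      rw [← Finset.sum_mul, (softmax_mem_stdSimplex _).2, one_mul]
    rw [Finset.sum_congr rfl fun k _ => hsum k, sub_self]
    exact Real.sqrt_nonneg _
  · have hlog : 0 < Real.log (Fintype.card I) :=
      Real.log_pos (by exact_mod_cast Fintype.one_lt_card)
    have hT' : (0 : ℝ) < T := by exact_mod_cast hT
    have h := exponentialWeights_regret (learningRate I T) hg T i
    have hη : 0 < learningRate I T := Real.sqrt_pos.2 (by positivity)
    have hηsq : learningRate I T ^ 2 = 8 * Real.log (Fintype.card I) / T :=
      Real.sq_sqrt (by positivity)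
    refine le_of_mul_le_mul_left ?_ hη
    have hprod : learningRate I T * Real.sqrt (1 / 2 * T * Real.log (Fintype.card I)) =
        2 * Real.log (Fintype.card I) := by
      rw [learningRate, ← Real.sqrt_mul (by positivity), Real.sqrt_eq_iff_mul_self_eq
        (by positivity) (by positivity)]
      field_simp
      ring
    have hT8 : T * (learningRate I T ^ 2 / 8) = Real.log (Fintype.card I) := by
      rw [hηsq]
      field_simp
    rw [hprod, mul_sub]
    linarith

/-- Decisions that are stationary under the deviations drawn from the weights `w`: for every type
`θ`, playing as `θ` has the same reward as misreporting and relabelling according to `w θ`. -/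
theorem exists_stationary_decisions {Ω : Type*} [Fintype Ω] {w : Ω → Ω × (A → A) → ℝ}
    (hw : ∀ θ, w θ ∈ stdSimplex ℝ (Ω × (A → A))) :
    ∃ p : Ω → A → ℝ, (∀ θ, p θ ∈ stdSimplex ℝ A) ∧
      ∀ θ (v : A → ℝ), ∑ i, w θ i * ∑ a, p i.1 a * v (i.2 a) = ∑ a, p θ a * v a := by
  let L : (Ω → A → ℝ) →ₗ[ℝ] (Ω → A → ℝ) :=
    { toFun := fun p θ b => ∑ i, w θ i * ∑ a, p i.1 a * (if i.2 a = b then 1 else 0)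
      map_add' := fun p q => by
        ext θ b
        simp only [Pi.add_apply, add_mul, mul_add, Finset.sum_add_distrib]
      map_smul' := fun c p => by
        ext θ b
        simp only [Pi.smul_apply, smul_eq_mul, RingHom.id_apply, Finset.mul_sum]
        refine Finset.sum_congr rfl fun i _ => Finset.sum_congr rfl fun a _ => ?_
        ring }
  have hpair (p : Ω → A → ℝ) (θ : Ω) (v : A → ℝ) :
      ∑ b, L p θ b * v b = ∑ i, w θ i * ∑ a, p i.1 a * v (i.2 a) := by
    simp only [L, LinearMap.coe_mk, AddHom.coe_mk, Finset.sum_mul]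
    rw [Finset.sum_comm]
    refine Finset.sum_congr rfl fun i _ => ?_
    simp only [mul_assoc, ← Finset.mul_sum, Finset.sum_mul]
    rw [Finset.sum_comm]
    simp
  let K : Set (Ω → A → ℝ) := Set.univ.pi fun _ => stdSimplex ℝ A
  have hmaps : Set.MapsTo L K K := by
    intro p hp θ _
    refine ⟨fun b => Finset.sum_nonneg fun i _ => mul_nonneg ((hw θ).1 i) <|
      Finset.sum_nonneg fun a _ => mul_nonneg ((hp i.1 trivial).1 a) (by positivity), ?_⟩
    have h := hpair p θ fun _ => 1
    simp only [mul_one, fun θ' => (hp θ' trivial).2, (hw θ).2] at h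
    exact h
  obtain ⟨p, hp, hfix⟩ := exists_fixedPoint_of_mapsTo_compact_convex
    (isCompact_univ_pi fun _ => isCompact_stdSimplex ℝ A)
    (convex_pi fun _ _ => convex_stdSimplex ℝ A)
    (⟨fun _ => Pi.single (Classical.arbitrary A) 1, fun _ _ => single_mem_stdSimplex ℝ _⟩ :
      K.Nonempty) L.toContinuousLinearMap hmaps
  refine ⟨p, fun θ => hp θ trivial, fun θ v => ?_⟩
  rw [← hpair]
  exact congrArg (fun q : Ω → A → ℝ => ∑ b, q θ b * v b) hfix

/-- Decisions stationary under the exponential weights, with learning rate `η`, of the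
deviations' cumulative rewards `S`. -/
def stationaryDecisions (η : ℝ) (S : Θ → Θ × (A → A) → ℝ) : Θ → A → ℝ :=
  (exists_stationary_decisions fun θ => softmax_mem_stdSimplex fun i => η * S θ i).choose

theorem stationaryDecisions_mem_stdSimplex (η : ℝ) (S : Θ → Θ × (A → A) → ℝ) (θ : Θ) :
    stationaryDecisions η S θ ∈ stdSimplex ℝ A :=
  (exists_stationary_decisions fun θ => softmax_mem_stdSimplex fun i => η * S θ i).choose_spec.1 θ

theorem sum_softmax_mul_stationaryDecisions (η : ℝ) (S : Θ → Θ × (A → A) → ℝ) (θ : Θ)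
    (v : A → ℝ) :
    ∑ i, softmax (fun i => η * S θ i) i * ∑ a, stationaryDecisions η S i.1 a * v (i.2 a) =
      ∑ a, stationaryDecisions η S θ a * v a :=
  (exists_stationary_decisions fun θ =>
    softmax_mem_stdSimplex fun i => η * S θ i).choose_spec.2 θ v

/-- The reward of type `θ` when the decisions `p` are played and `θ` deviates by `i`. -/
def deviationReward (p u : Θ → A → ℝ) (θ : Θ) (i : Θ × (A → A)) : ℝ :=
  ∑ a, p i.1 a * u θ (i.2 a)

/-- Cumulative rewards of all deviations after `k` rounds against the rewards `u`, when
`stationaryDecisions` are played in every round. -/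
def cumulativeReward (η : ℝ) (u : ℕ → Θ → A → ℝ) : ℕ → Θ → Θ × (A → A) → ℝ
  | 0 => 0
  | k + 1 => cumulativeReward η u k +
      deviationReward (stationaryDecisions η (cumulativeReward η u k)) (u k)

theorem cumulativeReward_eq_sum (η : ℝ) (u : ℕ → Θ → A → ℝ) (k : ℕ) (θ : Θ)
    (i : Θ × (A → A)) :
    cumulativeReward η u k θ i = ∑ s ∈ range k,
      deviationReward (stationaryDecisions η (cumulativeReward η u s)) (u s) θ i := by
  induction k with
  | zero => rfl
  | succ k ih => rw [Finset.sum_range_succ, ← ih]; rfl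

theorem cumulativeReward_congr (η : ℝ) {u v : ℕ → Θ → A → ℝ} {k : ℕ}
    (h : ∀ s < k, u s = v s) : cumulativeReward η u k = cumulativeReward η v k := by
  induction k with
  | zero => rfl
  | succ k ih =>
    rw [cumulativeReward, cumulativeReward, ih fun s hs => h s (by omega), h k (by omega)]

theorem stationaryDecisions_regret {T : ℕ} (hT : 1 ≤ T) {u : ℕ → Θ → A → ℝ}
    (hu : ∀ t θ a, u t θ a ∈ Set.Icc (0 : ℝ) 1) (θ : Θ) (i : Θ × (A → A)) :
    ∑ t ∈ range T,
      ((∑ a, stationaryDecisions (learningRate (Θ × (A → A)) T)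
          (cumulativeReward (learningRate (Θ × (A → A)) T) u t) i.1 a * u t θ (i.2 a)) -
        ∑ a, stationaryDecisions (learningRate (Θ × (A → A)) T)
          (cumulativeReward (learningRate (Θ × (A → A)) T) u t) θ a * u t θ a) ≤
      Real.sqrt (1 / 2 * T * Real.log (Fintype.card (Θ × (A → A)))) := by
  set η := learningRate (Θ × (A → A)) T with hη
  let g (k : ℕ) (j : Θ × (A → A)) : ℝ :=
    deviationReward (stationaryDecisions η (cumulativeReward η u k)) (u k) θ j
  have hg (k : ℕ) (j : Θ × (A → A)) : g k j ∈ Set.Icc (0 : ℝ) 1 := by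
    have hp := stationaryDecisions_mem_stdSimplex η (cumulativeReward η u k) j.1
    refine ⟨Finset.sum_nonneg fun a _ => mul_nonneg (hp.1 a) (hu k θ _).1, ?_⟩
    rw [← hp.2]
    exact Finset.sum_le_sum fun a _ => mul_le_of_le_one_right (hp.1 a) (hu k θ _).2
  have h := exponentialWeights_regret_le_sqrt hT hg i
  rw [← hη] at h
  simp only [g, ← cumulativeReward_eq_sum] at h
  simp only [deviationReward, sum_softmax_mul_stationaryDecisions] at h
  rwa [cumulativeReward_eq_sum, ← Finset.sum_sub_distrib] at h

theorem sqrt_log_card_deviations_le (T : ℕ) :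
    Real.sqrt (1 / 2 * T * Real.log (Fintype.card (Θ × (A → A)))) ≤
      Real.sqrt ((1 / 2) * (T : ℝ) * Real.log (Fintype.card Θ)) +
        6 * Real.sqrt ((T : ℝ) * (Fintype.card A : ℝ) * Real.log (Fintype.card A)) +
        2 * (Fintype.card A : ℝ) * Real.log (Fintype.card A) := by
  have hΘ : (0 : ℝ) < Fintype.card Θ := by exact_mod_cast Fintype.card_pos
  have hA : (0 : ℝ) < Fintype.card A := by exact_mod_cast Fintype.card_pos
  have hlogA : 0 ≤ Real.log (Fintype.card A) := Real.log_natCast_nonneg _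
  have hlogΘ : 0 ≤ Real.log (Fintype.card Θ) := Real.log_natCast_nonneg _
  have hcard : Real.log (Fintype.card (Θ × (A → A))) =
      Real.log (Fintype.card Θ) + Fintype.card A * Real.log (Fintype.card A) := by
    rw [Fintype.card_prod, Fintype.card_fun]
    push_cast
    rw [Real.log_mul hΘ.ne' (by positivity), Real.log_pow]
  set x := 1 / 2 * (T : ℝ) * Real.log (Fintype.card Θ)
  set y := (T : ℝ) * Fintype.card A * Real.log (Fintype.card A)
  have hx : 0 ≤ x := by positivity
  have hy : 0 ≤ y := by positivity
  have hxy : Real.sqrt (1 / 2 * T * Real.log (Fintype.card (Θ × (A → A)))) ≤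
      Real.sqrt x + Real.sqrt y := by
    rw [hcard]
    refine Real.sqrt_le_iff.2 ⟨by positivity, ?_⟩
    have hxy' := mul_nonneg (Real.sqrt_nonneg x) (Real.sqrt_nonneg y)
    rw [add_sq, Real.sq_sqrt hx, Real.sq_sqrt hy]
    simp only [x, y] at hy hxy' ⊢
    nlinarith
  have : 0 ≤ 2 * (Fintype.card A : ℝ) * Real.log (Fintype.card A) := by positivity
  linarith [Real.sqrt_nonneg y]

/-- There exists an online algorithm whose untruthful swap regret is bounded by
`√((1/2)·T·log|Θ|) + 6·√(T·|A|·log|A|) + 2·|A|·log|A|` against every reward sequence. -/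
theorem untruthfulSwapRegret_upper_bound
    (ρ : Θ → ℝ) (hρ : IsDist ρ) (T : ℕ) (hT : 1 ≤ T) :
    ∃ F : (t : Fin T) → (Fin (t : ℕ) → Θ → A → ℝ) → (Θ → A → ℝ),
      (∀ t h θ, IsDist (F t h θ)) ∧
      ∀ u : Fin T → Θ → A → ℝ, (∀ t θ a, u t θ a ∈ Set.Icc (0 : ℝ) 1) →
        untruthfulSwapRegret ρ T
            (fun t => F t (fun s => u (Fin.castLE t.isLt.le s))) u ≤
          Real.sqrt ((1 / 2) * (T : ℝ) * Real.log (Fintype.card Θ)) +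
            6 * Real.sqrt ((T : ℝ) * (Fintype.card A : ℝ) * Real.log (Fintype.card A)) +
            2 * (Fintype.card A : ℝ) * Real.log (Fintype.card A) := by
  let η := learningRate (Θ × (A → A)) T
  let extend (k : ℕ) (h : Fin k → Θ → A → ℝ) (s : ℕ) : Θ → A → ℝ :=
    if hs : s < k then h ⟨s, hs⟩ else 0
  refine ⟨fun t h => stationaryDecisions η (cumulativeReward η (extend t h) t), ?_, ?_⟩
  · intro t h θ
    have hp := stationaryDecisions_mem_stdSimplex η (cumulativeReward η (extend t h) t) θ
    exact ⟨mem_Icc_of_mem_stdSimplex hp, hp.2⟩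
  · intro u hu
    have hcausal (t : Fin T) :
        cumulativeReward η (extend t fun s => u (Fin.castLE t.isLt.le s)) t =
          cumulativeReward η (extend T u) t :=
      cumulativeReward_congr η fun s hs => by
        simp only [extend, dif_pos hs, dif_pos (hs.trans t.isLt)]
        rfl
    have hext (t : Fin T) : extend T u t = u t := by simp [extend]
    have hmem (t : ℕ) (θ : Θ) (a : A) : extend T u t θ a ∈ Set.Icc (0 : ℝ) 1 := by
      by_cases ht : t < T
      · simpa [extend, ht] using hu ⟨t, ht⟩ θ a
      · simp [extend, ht]
    refine ciSup_le fun ψ => ciSup_le fun φ => ?_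
    refine le_trans ?_ (sqrt_log_card_deviations_le T)
    set B := Real.sqrt (1 / 2 * T * Real.log (Fintype.card (Θ × (A → A))))
    rw [Finset.sum_comm]
    calc _ ≤ ∑ θ, ρ θ * B := by
          refine Finset.sum_le_sum fun θ _ => ?_
          rw [← Finset.mul_sum]
          refine mul_le_mul_of_nonneg_left ?_ (hρ.1 θ).1
          have h := stationaryDecisions_regret hT hmem θ (ψ θ, φ θ)
          rw [← Fin.sum_univ_eq_sum_range (fun t =>
            (∑ a, stationaryDecisions η (cumulativeReward η (extend T u) t) (ψ θ) a *
              extend T u t θ (φ θ a)) -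
            ∑ a, stationaryDecisions η (cumulativeReward η (extend T u) t) θ a *
              extend T u t θ a)] at h
          simpa only [hcausal, hext] using h
      _ = B := by rw [← Finset.sum_mul, hρ.2, one_mul]
end
end

section
/- Let A = {α₀, α₁} be a two-element action set, B ≥ 1 an integer, Θ a finite type set with |Θ| = 2^{B+1}, T a positive multiple of B with T ≥ 2^{−49}·|Θ|²·log₂|Θ|, and ρ the uniform distribution on Θ. Then for every deterministic online algorithm—every family of functions F^t : ([0,1]^{Θ×A})^{t−1} → Δ(A)^Θ for t = 1,…,T—there exists a sequence of reward vectors u^1,…,u^T ∈ [0,1]^{Θ×A} such that the decisions π^t = F^t(u^1,…,u^{t−1}) have untruthful swap regret R_US ≥ 2^{−28}·√(T·log₂|Θ|). -/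
open Finset
open scoped Classical

noncomputable section

variable {Θ A : Type*} [Fintype Θ] [Fintype A]

section RandomSigns

/-- The real sign `±1` encoded by a Boolean. -/
def boolSign (b : Bool) : ℝ := if b then 1 else -1

lemma boolSign_not (b : Bool) : boolSign (!b) = -boolSign b := by
  cases b <;> simp [boolSign]

lemma boolSign_sq (b : Bool) : boolSign b ^ 2 = 1 := by
  cases b <;> simp [boolSign]

lemma boolSign_decide_mul_self (s : ℝ) : boolSign (decide (0 ≤ s)) * s = |s| := by
  by_cases h : 0 ≤ s
  · simp [boolSign, h, abs_of_nonneg h]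
  · simp [boolSign, h, abs_of_neg (not_le.mp h)]

variable {ι : Type*}

section Flip

variable [DecidableEq ι]

/-- Flip the coordinate `t` of `σ`. -/
def flipAt (t : ι) (σ : ι → Bool) : ι → Bool := Function.update σ t (!σ t)

lemma flipAt_self (t : ι) (σ : ι → Bool) : flipAt t σ t = !σ t := by
  simp [flipAt]

lemma flipAt_of_ne {s t : ι} (h : s ≠ t) (σ : ι → Bool) : flipAt t σ s = σ s := by
  simp [flipAt, h]

lemma flipAt_involutive (t : ι) : Function.Involutive (flipAt t) := by
  intro σ
  simp [flipAt]

/-- The sum of the signs of `σ` over `J`. -/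
def signSum (J : Finset ι) (σ : ι → Bool) : ℝ := ∑ t ∈ J, boolSign (σ t)

lemma signSum_flipAt {J : Finset ι} {t : ι} (h : t ∉ J) (σ : ι → Bool) :
    signSum J (flipAt t σ) = signSum J σ :=
  Finset.sum_congr rfl fun s hs => by
    rw [flipAt_of_ne (ne_of_mem_of_not_mem hs h)]

variable [Fintype ι]

lemma sum_flipAt (t : ι) (f : (ι → Bool) → ℝ) : ∑ σ, f (flipAt t σ) = ∑ σ, f σ :=
  (flipAt_involutive t).bijective.sum_comp f

lemma sum_mul_boolSign_eq_zero (t : ι) (f : (ι → Bool) → ℝ)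
    (hf : ∀ σ, f (flipAt t σ) = f σ) : ∑ σ, f σ * boolSign (σ t) = 0 := by
  have h := sum_flipAt t (fun σ => f σ * boolSign (σ t))
  simp only [hf, flipAt_self, boolSign_not, mul_neg, Finset.sum_neg_distrib] at h
  linarith

lemma sum_signSum_sq (J : Finset ι) :
    ∑ σ : ι → Bool, signSum J σ ^ 2 = Fintype.card (ι → Bool) * (J.card : ℝ) := by
  induction J using Finset.induction_on with
  | empty => simp [signSum]
  | insert t J ht ih =>
    have h1 := sum_mul_boolSign_eq_zero t (fun σ => 2 * signSum J σ)
      (fun σ => by rw [signSum_flipAt ht])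
    have h2 : ∀ σ : ι → Bool, signSum (insert t J) σ ^ 2 =
        signSum J σ ^ 2 + 2 * signSum J σ * boolSign (σ t) + 1 := by
      intro σ
      have h3 : signSum (insert t J) σ = boolSign (σ t) + signSum J σ := Finset.sum_insert ht
      rw [h3]
      linear_combination boolSign_sq (σ t)
    simp only [h2, Finset.sum_add_distrib, h1, ih, Finset.card_insert_of_notMem ht]
    simp
    ring

lemma sum_signSum_pow_four_le (J : Finset ι) :
    ∑ σ : ι → Bool, signSum J σ ^ 4 ≤ Fintype.card (ι → Bool) * (3 * (J.card : ℝ) ^ 2) := by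
  induction J using Finset.induction_on with
  | empty => simp [signSum]
  | insert t J ht ih =>
    have h1 := sum_mul_boolSign_eq_zero t (fun σ => 4 * signSum J σ ^ 3 + 4 * signSum J σ)
      (fun σ => by rw [signSum_flipAt ht])
    have h2 : ∀ σ : ι → Bool, signSum (insert t J) σ ^ 4 =
        signSum J σ ^ 4 + (4 * signSum J σ ^ 3 + 4 * signSum J σ) * boolSign (σ t) +
          6 * signSum J σ ^ 2 + 1 := by
      intro σ
      have h3 : signSum (insert t J) σ = boolSign (σ t) + signSum J σ := Finset.sum_insert ht
      rw [h3]
      linear_combination (boolSign (σ t) ^ 2 + 1 + 4 * boolSign (σ t) * signSum J σ +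
        6 * signSum J σ ^ 2) * boolSign_sq (σ t)
    have h4 := sum_signSum_sq J
    have h5 : ∑ σ : ι → Bool, (1 : ℝ) = Fintype.card (ι → Bool) := by simp
    simp only [h2, Finset.sum_add_distrib, h1, ← Finset.mul_sum, h4, h5,
      Finset.card_insert_of_notMem ht]
    have h6 : (0 : ℝ) ≤ Fintype.card (ι → Bool) := by positivity
    push_cast
    nlinarith

/-- A Khintchine inequality for the first moment of a sum of random signs. -/
lemma le_sum_abs_signSum (J : Finset ι) :
    Fintype.card (ι → Bool) * (√J.card / 2) ≤ ∑ σ : ι → Bool, |signSum J σ| := by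
  rcases J.eq_empty_or_nonempty with rfl | hJ
  · simp [signSum]
  have hc : (0 : ℝ) < J.card := by exact_mod_cast hJ.card_pos
  set K : ℝ := √J.card with hK
  have hKpos : 0 < K := Real.sqrt_pos.mpr hc
  have hKsq : (J.card : ℝ) = K ^ 2 := (Real.sq_sqrt hc.le).symm
  clear_value K
  have hpt : ∀ s : ℝ, 3 / (4 * K) * s ^ 2 - 1 / (16 * K ^ 3) * s ^ 4 ≤ |s| := by
    intro s
    obtain ⟨y, hy, hs⟩ : ∃ y : ℝ, 0 ≤ y ∧ |s| = 2 * K * y :=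
      ⟨|s| / (2 * K), by positivity, by field_simp⟩
    have e2 : s ^ 2 = (2 * K * y) ^ 2 := by rw [← hs, sq_abs]
    have e4 : s ^ 4 = ((2 * K * y) ^ 2) ^ 2 := by rw [← e2]; ring
    rw [e2, e4, hs]
    have e : 2 * K * y - (3 / (4 * K) * (2 * K * y) ^ 2 - 1 / (16 * K ^ 3) * ((2 * K * y) ^ 2) ^ 2)
        = K * y * (y - 1) ^ 2 * (y + 2) := by
      field_simp
      ring
    have : 0 ≤ K * y * (y - 1) ^ 2 * (y + 2) := by positivity
    linarith
  have h := Finset.sum_le_sum (s := Finset.univ) fun (σ : ι → Bool) _ => hpt (signSum J σ)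
  rw [Finset.sum_sub_distrib, ← Finset.mul_sum, ← Finset.mul_sum, sum_signSum_sq] at h
  refine le_trans ?_ h
  have h4 := mul_le_mul_of_nonneg_left (sum_signSum_pow_four_le J)
    (show 0 ≤ 1 / (16 * K ^ 3) by positivity)
  refine le_trans ?_ (sub_le_sub_left h4 _)
  rw [hKsq]
  have e : 3 / (4 * K) * (Fintype.card (ι → Bool) * K ^ 2) -
      1 / (16 * K ^ 3) * (Fintype.card (ι → Bool) * (3 * (K ^ 2) ^ 2)) =
      Fintype.card (ι → Bool) * (9 / 16 * K) := by
    field_simp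
    ring
  rw [e]
  gcongr
  linarith

end Flip

section Predictable

variable [LinearOrder ι]

/-- `f` depends only on the coordinates before `t`. -/
def IsPredictableAt (t : ι) (f : (ι → Bool) → ℝ) : Prop :=
  ∀ σ σ', (∀ s < t, σ s = σ' s) → f σ = f σ'

lemma IsPredictableAt.flipAt {s t : ι} {f : (ι → Bool) → ℝ} (hf : IsPredictableAt s f)
    (h : s ≤ t) (σ : ι → Bool) : f (flipAt t σ) = f σ :=
  hf _ _ fun _ hr => flipAt_of_ne (hr.trans_le h).ne σ

variable [Fintype ι]

/-- The exponential supermartingale inequality for predictable transforms of random signs. -/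
lemma sum_exp_predictable_le (a : ι → (ι → Bool) → ℝ) (ha : ∀ t, IsPredictableAt t (a t))
    (s : Finset ι) :
    ∑ σ : ι → Bool, Real.exp (∑ t ∈ s, (a t σ * boolSign (σ t) - a t σ ^ 2 / 2)) ≤
      Fintype.card (ι → Bool) := by
  induction s using Finset.induction_on_max with
  | empty => simp
  | insert k s hk ih =>
    have hks : k ∉ s := fun h => lt_irrefl _ (hk k h)
    refine le_trans ?_ ih
    set Φ : (ι → Bool) → ℝ := fun σ =>
      Real.exp (∑ t ∈ s, (a t σ * boolSign (σ t) - a t σ ^ 2 / 2)) with hΦ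
    have hΦflip : ∀ σ, Φ (flipAt k σ) = Φ σ := by
      intro σ
      simp only [hΦ]
      congr 1
      refine Finset.sum_congr rfl fun t ht => ?_
      rw [(ha t).flipAt (hk t ht).le, flipAt_of_ne (hk t ht).ne]
    set f : (ι → Bool) → ℝ := fun σ =>
      Real.exp (a k σ * boolSign (σ k) - a k σ ^ 2 / 2) * Φ σ with hf
    have h1 : ∀ σ, f σ + f (flipAt k σ) ≤ 2 * Φ σ := by
      intro σ
      simp only [hf, hΦflip, (ha k).flipAt le_rfl, flipAt_self, boolSign_not]
      have h2 := Real.cosh_le_exp_half_sq (a k σ * boolSign (σ k))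
      rw [mul_pow, boolSign_sq, mul_one, Real.cosh_eq] at h2
      have h3 : Real.exp (a k σ * boolSign (σ k) - a k σ ^ 2 / 2) +
          Real.exp (a k σ * -boolSign (σ k) - a k σ ^ 2 / 2) ≤ 2 := by
        rw [Real.exp_sub, Real.exp_sub, ← add_div, div_le_iff₀ (Real.exp_pos _), mul_neg]
        linarith
      have h4 : 0 ≤ Φ σ := (Real.exp_pos _).le
      nlinarith
    have h5 := Finset.sum_le_sum (s := Finset.univ) fun σ _ => h1 σ
    rw [Finset.sum_add_distrib, sum_flipAt k f, ← Finset.mul_sum] at h5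
    have h6 : ∀ σ : ι → Bool,
        Real.exp (∑ t ∈ insert k s, (a t σ * boolSign (σ t) - a t σ ^ 2 / 2)) = f σ := by
      intro σ
      rw [Finset.sum_insert hks, Real.exp_add]
    simp only [h6]
    linarith

end Predictable

end RandomSigns

section Blocks

variable {T L m : ℕ}

/-- The rounds in the `j`-th block of length `L`. -/
def block (T L j : ℕ) : Finset (Fin T) := univ.filter fun t => (t : ℕ) / L = j

lemma card_block {j : ℕ} (hL : 0 < L) (hj : (j + 1) * L ≤ T) : (block T L j).card = L := by
  have h : (block T L j).map Fin.valEmbedding = Finset.Ico (j * L) (j * L + L) := by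
    ext n
    simp only [block, Finset.mem_map, Finset.mem_filter, Finset.mem_univ, true_and,
      Fin.valEmbedding_apply, Finset.mem_Ico]
    constructor
    · rintro ⟨t, ht, rfl⟩
      rw [Nat.div_eq_iff hL] at ht
      rcases ht with ⟨h1, h2⟩
      constructor <;> omega
    · rintro ⟨h1, h2⟩
      have hn : n < T := by
        rw [add_mul] at hj
        omega
      refine ⟨⟨n, hn⟩, ?_, rfl⟩
      change n / L = j
      rw [Nat.div_eq_iff hL]
      constructor <;> omega
  rw [← Finset.card_map Fin.valEmbedding, h]
  simp

/-- A sum over the rounds of the first `m` blocks, arranged by blocks. -/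
lemma sum_ite_div_lt (f : Fin T → ℝ) :
    ∑ t : Fin T, (if (t : ℕ) / L < m then f t else 0) =
      ∑ j ∈ Finset.range m, ∑ t ∈ block T L j, f t := by
  simp only [block, Finset.sum_filter]
  rw [Finset.sum_comm]
  refine Finset.sum_congr rfl fun t _ => ?_
  rw [Finset.sum_ite_eq]
  simp

/-- Extend a finite pattern of bits by `false`. -/
def extendBits (x : Fin m → Bool) (j : ℕ) : Bool := if h : j < m then x ⟨j, h⟩ else false

/-- The sign that the pattern `x` prescribes in round `t`, zero after the first `m` blocks. -/
def patternSign (L : ℕ) (x : Fin m → Bool) (t : Fin T) : ℝ :=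
  if (t : ℕ) / L < m then boolSign (extendBits x (t / L)) else 0

/-- The pattern recording the majority sign of `σ` in each block. -/
def majorityPattern (L m : ℕ) (σ : Fin T → Bool) : Fin m → Bool :=
  fun j => decide (0 ≤ signSum (block T L j) σ)

lemma sum_patternSign_majority (σ : Fin T → Bool) :
    ∑ t, patternSign L (majorityPattern L m σ) t * boolSign (σ t) =
      ∑ j ∈ Finset.range m, |signSum (block T L j) σ| := by
  simp only [patternSign, ite_mul, zero_mul]
  rw [sum_ite_div_lt]
  refine Finset.sum_congr rfl fun j hj => ?_
  rw [← boolSign_decide_mul_self, signSum, Finset.mul_sum]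
  refine Finset.sum_congr rfl fun t ht => ?_
  have ht' : (t : ℕ) / L = j := (Finset.mem_filter.mp ht).2
  rw [ht', extendBits, dif_pos (Finset.mem_range.mp hj)]
  rfl

/-- If, along every sign sequence, each pattern is followed up to few mistakes, then along some
sign sequence the majority pattern collects a gain linear in the number of blocks. -/
lemma exists_large_gain (hL : 0 < L) (hT : m * L ≤ T)
    (W : (Fin m → Bool) → Fin T → (Fin T → Bool) → ℝ) (c : Fin T → (Fin T → Bool) → ℝ)
    (hW : ∀ x t, IsPredictableAt t (W x t)) (hc : ∀ t, IsPredictableAt t (c t))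
    (hW0 : ∀ x t σ, 0 ≤ W x t σ) (hW1 : ∀ x t σ, W x t σ ≤ 1)
    (hfollow : ∀ σ x, ∀ j < m, ∑ t ∈ block T L j, W x t σ ≤ (L : ℝ) / 64) :
    ∃ (σ : Fin T → Bool) (x : Fin m → Bool), m * √L / 16 ≤
      ∑ t, (patternSign L x t / 2 - W x t σ * patternSign L x t - c t σ) * boolSign (σ t) := by
  by_contra! hcon
  have hLpos : (0 : ℝ) < √L := Real.sqrt_pos.mpr (by exact_mod_cast hL)
  have hLsq : (L : ℝ) = √L ^ 2 := (Real.sq_sqrt (by positivity)).symm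
  set S : ℝ := √L with hS
  clear_value S
  set N : ℝ := (Fintype.card (Fin T → Bool) : ℝ) with hN
  have hNpos : 0 < N := by
    rw [hN]
    exact_mod_cast Fintype.card_pos
  let a : (Fin m → Bool) → Fin T → (Fin T → Bool) → ℝ :=
    fun x t σ => 8 / S * (W x t σ * patternSign L x t)
  let Z : (Fin m → Bool) → (Fin T → Bool) → ℝ :=
    fun x σ => ∑ t, (a x t σ * boolSign (σ t) - a x t σ ^ 2 / 2)
  have hexp : ∑ σ, ∑ x, Real.exp (Z x σ) ≤ 2 ^ m * N := by
    rw [Finset.sum_comm]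
    calc ∑ x, ∑ σ, Real.exp (Z x σ) ≤ ∑ x : Fin m → Bool, N := by
          refine Finset.sum_le_sum fun x _ => sum_exp_predictable_le (a x) (fun t σ σ' h => ?_) _
          simp only [a, hW x t σ σ' h]
      _ = 2 ^ m * N := by simp
  have hV : ∀ x σ, ∑ t, a x t σ ^ 2 / 2 ≤ (m : ℝ) / 2 := by
    intro x σ
    calc ∑ t, a x t σ ^ 2 / 2
        ≤ ∑ t : Fin T, (if (t : ℕ) / L < m then 32 / S ^ 2 * W x t σ else 0) := by
          refine Finset.sum_le_sum fun t _ => ?_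
          simp only [a, patternSign]
          split_ifs
          · rw [mul_pow, mul_pow, boolSign_sq]
            have h1 : W x t σ ^ 2 ≤ W x t σ := by
              nlinarith [hW0 x t σ, hW1 x t σ]
            calc (8 / S) ^ 2 * (W x t σ ^ 2 * 1) / 2 = 32 / S ^ 2 * W x t σ ^ 2 := by ring
              _ ≤ _ := by gcongr
          · simp
      _ = ∑ j ∈ Finset.range m, 32 / S ^ 2 * ∑ t ∈ block T L j, W x t σ := by
          rw [sum_ite_div_lt]
          simp only [Finset.mul_sum]
      _ ≤ ∑ j ∈ Finset.range m, 32 / S ^ 2 * ((L : ℝ) / 64) := by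
          refine Finset.sum_le_sum fun j hj => ?_
          gcongr
          exact hfollow σ x j (Finset.mem_range.mp hj)
      _ = m / 2 := by
          rw [hLsq]
          simp
          field_simp
          ring
  have hM : ∀ x σ, 8 / S * ∑ t, W x t σ * patternSign L x t * boolSign (σ t) ≤
      3 / 2 * m - 1 + (∑ x, Real.exp (Z x σ)) / 2 ^ m := by
    intro x σ
    have h1 : 8 / S * ∑ t, W x t σ * patternSign L x t * boolSign (σ t) =
        Z x σ + ∑ t, a x t σ ^ 2 / 2 := by
      simp only [Z, ← Finset.sum_add_distrib, Finset.mul_sum]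
      refine Finset.sum_congr rfl fun t _ => ?_
      simp only [a]
      ring
    have h2 : Real.exp (Z x σ) ≤ ∑ x, Real.exp (Z x σ) :=
      Finset.single_le_sum (f := fun x => Real.exp (Z x σ)) (fun _ _ => (Real.exp_pos _).le)
        (Finset.mem_univ x)
    have h3 := Real.add_one_le_exp (Z x σ - m * Real.log 2)
    rw [Real.exp_sub, mul_comm (m : ℝ), Real.exp_mul, Real.exp_log (by norm_num),
      Real.rpow_natCast] at h3
    have h4 : Real.exp (Z x σ) / 2 ^ m ≤ (∑ x, Real.exp (Z x σ)) / 2 ^ m := by gcongr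
    have h5 : Real.log 2 * m ≤ 1 * m := by
      gcongr
      linarith [Real.log_two_lt_d9]
    linarith [hV x σ]
  have hMsum : ∑ σ, ∑ t, W (majorityPattern L m σ) t σ *
      patternSign L (majorityPattern L m σ) t * boolSign (σ t) ≤ N * (3 / 16 * m * S) := by
    have h1 := Finset.sum_le_sum (s := Finset.univ) fun (σ : Fin T → Bool) _ =>
      hM (majorityPattern L m σ) σ
    rw [← Finset.mul_sum, Finset.sum_add_distrib, ← Finset.sum_div] at h1
    have h2 : (∑ σ, ∑ x, Real.exp (Z x σ)) / 2 ^ m ≤ N := by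
      rw [div_le_iff₀ (by positivity)]
      linarith
    have h3 : ∑ σ : Fin T → Bool, (3 / 2 * (m : ℝ) - 1) = N * (3 / 2 * m - 1) := by
      rw [Finset.sum_const, nsmul_eq_mul]
      rfl
    rw [h3] at h1
    rw [div_mul_eq_mul_div, div_le_iff₀ hLpos] at h1
    nlinarith
  have habs : N * (m * S / 2) ≤ ∑ σ : Fin T → Bool,
      ∑ t, patternSign L (majorityPattern L m σ) t * boolSign (σ t) := by
    simp only [sum_patternSign_majority]
    rw [Finset.sum_comm]
    calc N * (m * S / 2) = ∑ j ∈ Finset.range m, N * (S / 2) := by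
          simp
          ring
      _ ≤ _ := by
          refine Finset.sum_le_sum fun j hj => ?_
          have h := le_sum_abs_signSum (block T L j)
          rwa [card_block hL ((Nat.mul_le_mul_right L (Finset.mem_range.mp hj)).trans hT),
            ← hS] at h
  have hown : ∑ σ, ∑ t, c t σ * boolSign (σ t) = 0 := by
    rw [Finset.sum_comm]
    exact Finset.sum_eq_zero fun t _ =>
      sum_mul_boolSign_eq_zero t (c t) ((hc t).flipAt le_rfl)
  have htotal := Finset.sum_lt_sum_of_nonempty (s := Finset.univ) Finset.univ_nonempty
    fun (σ : Fin T → Bool) _ => hcon σ (majorityPattern L m σ)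
  have hsplit : ∀ σ : Fin T → Bool,
      ∑ t, (patternSign L (majorityPattern L m σ) t / 2 -
        W (majorityPattern L m σ) t σ * patternSign L (majorityPattern L m σ) t - c t σ) *
          boolSign (σ t) =
      (∑ t, patternSign L (majorityPattern L m σ) t * boolSign (σ t)) / 2 -
        ∑ t, W (majorityPattern L m σ) t σ * patternSign L (majorityPattern L m σ) t *
          boolSign (σ t) - ∑ t, c t σ * boolSign (σ t) := by
    intro σ
    rw [Finset.sum_div, ← Finset.sum_sub_distrib, ← Finset.sum_sub_distrib]
    refine Finset.sum_congr rfl fun t _ => ?_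
    ring
  simp only [hsplit, Finset.sum_sub_distrib, ← Finset.sum_div, hown] at htotal
  rw [Finset.sum_const, nsmul_eq_mul, Finset.card_univ, ← hN] at htotal
  linarith

end Blocks

section Construction

lemma le_untruthfulSwapRegret {Θ A : Type*} [Fintype Θ] [Fintype A] (ρ : Θ → ℝ) (T : ℕ)
    (π u : Fin T → Θ → A → ℝ) (ψ : Θ → Θ) (φ : Θ → A → A) :
    ∑ t, ∑ θ, ρ θ * ((∑ a, π t (ψ θ) a * u t θ (φ θ a)) - ∑ a, π t θ a * u t θ a) ≤
      untruthfulSwapRegret ρ T π u :=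
  le_ciSup_of_le (Set.finite_range _).bddAbove ψ
    (le_ciSup (f := fun φ : Θ → A → A => ∑ t, ∑ θ, ρ θ *
      ((∑ a, π t (ψ θ) a * u t θ (φ θ a)) - ∑ a, π t θ a * u t θ a))
      (Set.finite_range _).bddAbove φ)

variable {Θ A Y : Type*} {T m : ℕ}

/-- Rewards of the first `k` blocks of length `L`, all rewards being zero afterwards: half of the
types are rewarded for guessing `σ`, the others for following the pattern they encode, with
stakes growing geometrically from block to block. -/
def blockReward (eA : A ≃ Bool) (eΘ : Θ ≃ Bool × (Fin m → Bool) × Y) (L k : ℕ)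
    (σ : Fin T → Bool) (t : Fin T) (θ : Θ) (a : A) : ℝ :=
  if (t : ℕ) / L < k then
    (if (eΘ θ).1 then (if eA a = σ t then 1 else 0)
      else if eA a = extendBits (eΘ θ).2.1 (t / L) then 256 ^ ((t : ℕ) / L) / 256 ^ m else 0)
  else 0

lemma blockReward_mem_Icc (eA : A ≃ Bool) (eΘ : Θ ≃ Bool × (Fin m → Bool) × Y) (L : ℕ) {k : ℕ}
    (hk : k ≤ m) (σ : Fin T → Bool) (t : Fin T) (θ : Θ) (a : A) :
    blockReward eA eΘ L k σ t θ a ∈ Set.Icc (0 : ℝ) 1 := by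
  unfold blockReward
  split_ifs with h
  any_goals simp
  refine ⟨by positivity, ?_⟩
  rw [div_le_one (by positivity)]
  exact pow_le_pow_right₀ (by norm_num) (h.le.trans hk)

variable [Fintype Y]

/-- The average mistake probability in block `j` of the types encoding the pattern `x`. -/
def followError (eA : A ≃ Bool) (eΘ : Θ ≃ Bool × (Fin m → Bool) × Y) (q : Θ → A → ℝ)
    (x : Fin m → Bool) (j : ℕ) : ℝ :=
  (∑ y, (1 - q (eΘ.symm (false, x, y)) (eA.symm (extendBits x j)))) / Fintype.card Y

/-- The average bias towards the action `true` of the types rewarded for guessing. -/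
def guessBias (eA : A ≃ Bool) (eΘ : Θ ≃ Bool × (Fin m → Bool) × Y) (q : Θ → A → ℝ) : ℝ :=
  (∑ x, ∑ y, (q (eΘ.symm (true, x, y)) (eA.symm true) - 1 / 2)) / (2 ^ m * Fintype.card Y)

variable [Fintype A]

lemma followError_nonneg (eA : A ≃ Bool) (eΘ : Θ ≃ Bool × (Fin m → Bool) × Y)
    {q : Θ → A → ℝ} (hq : ∀ θ, IsDist (q θ)) (x : Fin m → Bool) (j : ℕ) :
    0 ≤ followError eA eΘ q x j :=
  div_nonneg (Finset.sum_nonneg fun _ _ => sub_nonneg.mpr ((hq _).1 _).2) (by positivity)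

lemma followError_le_one (eA : A ≃ Bool) (eΘ : Θ ≃ Bool × (Fin m → Bool) × Y)
    {q : Θ → A → ℝ} (hq : ∀ θ, IsDist (q θ)) (x : Fin m → Bool) (j : ℕ) :
    followError eA eΘ q x j ≤ 1 := by
  refine div_le_one_of_le₀ ?_ (by positivity)
  calc _ ≤ ∑ y : Y, (1 : ℝ) :=
        Finset.sum_le_sum fun _ _ => sub_le_self _ ((hq _).1 _).1
    _ = _ := by simp

lemma sum_eq_add_of_equiv_bool (eA : A ≃ Bool) (f : A → ℝ) :
    ∑ a, f a = f (eA.symm true) + f (eA.symm false) := by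
  rw [← Equiv.sum_comp eA.symm f, Fintype.sum_bool]

lemma sum_mul_ite_eq (eA : A ≃ Bool) (q : A → ℝ) (b : Bool) (g : ℝ) :
    ∑ a, q a * (if eA a = b then g else 0) = g * q (eA.symm b) := by
  rw [sum_eq_add_of_equiv_bool eA]
  cases b <;> simp [mul_comm]

variable [Fintype Θ]

lemma sum_types (eΘ : Θ ≃ Bool × (Fin m → Bool) × Y) (f : Θ → ℝ) :
    ∑ θ, f θ = (∑ x, ∑ y, f (eΘ.symm (true, x, y))) + ∑ x, ∑ y, f (eΘ.symm (false, x, y)) := by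
  rw [← Equiv.sum_comp eΘ.symm f, Fintype.sum_prod_type, Fintype.sum_bool,
    Fintype.sum_prod_type, Fintype.sum_prod_type]

/-- If the types encoding `x` err too often in block `k`, then stopping the rewards after that
block leaves them with a large regret against the action prescribed there. -/
lemma le_regret_of_followError [Nonempty Y] (eA : A ≃ Bool)
    (eΘ : Θ ≃ Bool × (Fin m → Bool) × Y)
    {L k : ℕ} (hL : 0 < L) (hk : k < m) (hT : m * L ≤ T) {ρ : ℝ} (hρ : 0 ≤ ρ)
    {π : Fin T → Θ → A → ℝ} (hπ : ∀ t θ, IsDist (π t θ)) (σ : Fin T → Bool) (x : Fin m → Bool)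
    (hdev : (L : ℝ) / 64 ≤ ∑ t ∈ block T L k, followError eA eΘ (π t) x k) :
    ρ * (Fintype.card Y * L / (128 * 256 ^ m)) ≤
      untruthfulSwapRegret (fun _ => ρ) T π (blockReward eA eΘ L (k + 1) σ) := by
  set b : A := eA.symm (extendBits x k) with hb
  set K : ℝ := (Fintype.card Y : ℝ) with hK
  have hKpos : 0 < K := by
    rw [hK]
    exact_mod_cast Fintype.card_pos
  let φ : Θ → A → A := fun θ a => if (eΘ θ).1 = false ∧ (eΘ θ).2.1 = x then b else a
  refine le_trans ?_ (le_untruthfulSwapRegret _ T π _ id φ)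
  simp only [id, ← Finset.mul_sum]
  gcongr ρ * ?_
  let g : ℕ → ℝ := fun j => 256 ^ j / 256 ^ m
  have hg : ∀ j, 0 ≤ g j := fun j => by positivity
  have hround : ∀ t : Fin T,
      (if (t : ℕ) / L < k + 1 then
        (if (t : ℕ) / L = k then g k * (K * followError eA eΘ (π t) x k) else -(K * g (t / L)))
        else 0) ≤
      ∑ θ, ((∑ a, π t θ a * blockReward eA eΘ L (k + 1) σ t θ (φ θ a)) -
        ∑ a, π t θ a * blockReward eA eΘ L (k + 1) σ t θ a) := by
    intro t
    by_cases ht : (t : ℕ) / L < k + 1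
    swap
    · simp [blockReward, ht]
    rw [if_pos ht, sum_types eΘ, Finset.sum_eq_zero, zero_add, Finset.sum_eq_single x]
    rotate_left
    · intro x' _ hx'
      simp [φ, hx']
    · simp
    · intro x' _
      simp [φ]
    have hcalc : ∀ y, (∑ a, π t (eΘ.symm (false, x, y)) a *
          blockReward eA eΘ L (k + 1) σ t (eΘ.symm (false, x, y)) (φ (eΘ.symm (false, x, y)) a)) -
        ∑ a, π t (eΘ.symm (false, x, y)) a *
          blockReward eA eΘ L (k + 1) σ t (eΘ.symm (false, x, y)) a =
        (if extendBits x k = extendBits x (t / L) then g (t / L) else 0) -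
          g (t / L) * π t (eΘ.symm (false, x, y)) (eA.symm (extendBits x (t / L))) := by
      intro y
      simp only [blockReward, ht, φ, Equiv.apply_symm_apply, if_true, Bool.false_eq_true, if_false,
        and_self, sum_mul_ite_eq, hb, ← Finset.sum_mul, (hπ t _).2, one_mul, g]
    simp only [hcalc]
    split_ifs with h1 h2 h2
    · rw [h1, followError, ← hK, mul_div_cancel₀ _ hKpos.ne', Finset.mul_sum]
      exact Finset.sum_le_sum fun y _ => by linarith
    · exact absurd (by rw [h1]) h2
    · calc -(K * g (t / L)) ≤ 0 := by
            have := mul_nonneg hKpos.le (hg (t / L))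
            linarith
        _ ≤ _ := Finset.sum_nonneg fun y _ => by
            have := mul_le_mul_of_nonneg_left ((hπ t (eΘ.symm (false, x, y))).1
              (eA.symm (extendBits x (t / L)))).2 (hg (t / L))
            linarith
    · calc -(K * g (t / L)) = ∑ y : Y, -g (t / L) := by simp [hK]
        _ ≤ _ := Finset.sum_le_sum fun y _ => by
            have := mul_le_mul_of_nonneg_left ((hπ t (eΘ.symm (false, x, y))).1
              (eA.symm (extendBits x (t / L)))).2 (hg (t / L))
            linarith
  refine le_trans ?_ (Finset.sum_le_sum fun t _ => hround t)
  rw [sum_ite_div_lt, Finset.sum_range_succ]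
  have hlast : ∑ t ∈ block T L k, (if (t : ℕ) / L = k then
      g k * (K * followError eA eΘ (π t) x k) else -(K * g (t / L))) =
      g k * K * ∑ t ∈ block T L k, followError eA eΘ (π t) x k := by
    rw [Finset.mul_sum]
    refine Finset.sum_congr rfl fun t ht => ?_
    rw [if_pos (Finset.mem_filter.mp ht).2, mul_assoc]
  have hprev : ∑ j ∈ Finset.range k, ∑ t ∈ block T L j, (if (t : ℕ) / L = k then
      g k * (K * followError eA eΘ (π t) x k) else -(K * g (t / L))) =
      -(K * L * ∑ j ∈ Finset.range k, g j) := by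
    rw [Finset.mul_sum, ← Finset.sum_neg_distrib]
    refine Finset.sum_congr rfl fun j hj => ?_
    have hjk := Finset.mem_range.mp hj
    calc _ = ∑ t ∈ block T L j, -(K * g j) := by
          refine Finset.sum_congr rfl fun t ht => ?_
          rw [(Finset.mem_filter.mp ht).2, if_neg hjk.ne]
      _ = _ := by
          rw [Finset.sum_const, card_block hL
            ((Nat.mul_le_mul_right L (hjk.trans hk)).trans hT), nsmul_eq_mul]
          ring
  have hgeom : ∑ j ∈ Finset.range k, g j ≤ g k / 255 := by
    simp only [g, ← Finset.sum_div]
    rw [geom_sum_eq (by norm_num), div_right_comm]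
    norm_num
    gcongr
    linarith
  have hgk : 1 / 256 ^ m ≤ g k := by
    simp only [g]
    gcongr
    exact one_le_pow₀ (by norm_num)
  rw [hlast, hprev]
  have hKL : 0 ≤ K * L := by positivity
  have e1 := mul_le_mul_of_nonneg_left hdev (mul_nonneg (hg k) hKpos.le)
  have e2 := mul_le_mul_of_nonneg_left hgeom hKL
  have e3 := mul_le_mul_of_nonneg_left hgk hKL
  have e4 : K * L / (128 * 256 ^ m) = K * L * (1 / 256 ^ m) / 128 := by ring
  have e5 := mul_nonneg hKL (hg k)
  rw [e4]
  linarith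

/-- Over the full reward sequence, the guessing types may imitate the types encoding `x`. -/
lemma le_regret_of_imitation [Nonempty Y] (eA : A ≃ Bool) (eΘ : Θ ≃ Bool × (Fin m → Bool) × Y)
    (L : ℕ) (ρ : ℝ) {π : Fin T → Θ → A → ℝ} (hπ : ∀ t θ, IsDist (π t θ))
    (σ : Fin T → Bool) (x : Fin m → Bool) :
    ρ * (2 ^ m * Fintype.card Y * ∑ t : Fin T, (patternSign L x t / 2 -
        followError eA eΘ (π t) x (t / L) * patternSign L x t -
        (if (t : ℕ) / L < m then guessBias eA eΘ (π t) else 0)) * boolSign (σ t)) ≤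
      untruthfulSwapRegret (fun _ => ρ) T π (blockReward eA eΘ L m σ) := by
  let ψ : Θ → Θ := fun θ => if (eΘ θ).1 then eΘ.symm (false, x, (eΘ θ).2.2) else θ
  refine le_trans (le_of_eq ?_) (le_untruthfulSwapRegret _ T π _ ψ fun _ => id)
  simp only [id, ← Finset.mul_sum]
  congr 1
  rw [Finset.mul_sum]
  refine Finset.sum_congr rfl fun t _ => ?_
  by_cases ht : (t : ℕ) / L < m
  swap
  · simp [blockReward, ht, patternSign]
  have hK : (Fintype.card Y : ℝ) ≠ 0 := by
    exact_mod_cast Fintype.card_ne_zero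
  have hguess : ∀ θ, π t θ (eA.symm (σ t)) =
      1 / 2 + (π t θ (eA.symm true) - 1 / 2) * boolSign (σ t) := by
    intro θ
    have h := (hπ t θ).2
    rw [sum_eq_add_of_equiv_bool eA] at h
    cases σ t
    · simp [boolSign]
      linarith
    · simp [boolSign]
  have hfollow : ∀ θ, π t θ (eA.symm (σ t)) = 1 / 2 +
      boolSign (extendBits x (t / L)) * boolSign (σ t) / 2 -
      (1 - π t θ (eA.symm (extendBits x (t / L)))) *
        (boolSign (extendBits x (t / L)) * boolSign (σ t)) := by
    intro θ
    have h := (hπ t θ).2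
    rw [sum_eq_add_of_equiv_bool eA] at h
    cases σ t <;> cases extendBits x (t / L) <;> (simp [boolSign]; linarith)
  rw [sum_types eΘ]
  simp only [blockReward, ht, ψ, Equiv.apply_symm_apply, if_true, Bool.false_eq_true, if_false,
    sub_self, Finset.sum_const_zero, add_zero, sum_mul_ite_eq, one_mul, patternSign,
    Finset.sum_sub_distrib]
  have h1 : ∑ y, π t (eΘ.symm (false, x, y)) (eA.symm (σ t)) = Fintype.card Y *
      (1 / 2 + boolSign (extendBits x (t / L)) * boolSign (σ t) / 2 -
        followError eA eΘ (π t) x (t / L) *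
          (boolSign (extendBits x (t / L)) * boolSign (σ t))) := by
    simp only [hfollow, Finset.sum_sub_distrib, ← Finset.sum_mul, followError]
    simp only [Finset.sum_const, Finset.card_univ, nsmul_eq_mul]
    field_simp
  have h2 : ∑ x, ∑ y, π t (eΘ.symm (true, x, y)) (eA.symm (σ t)) = 2 ^ m * Fintype.card Y *
      (1 / 2 + guessBias eA eΘ (π t) * boolSign (σ t)) := by
    simp only [hguess, Finset.sum_add_distrib, ← Finset.sum_mul, guessBias]
    simp only [Finset.sum_const, Finset.card_univ, nsmul_eq_mul]
    simp
    field_simp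
  rw [h2]
  simp only [h1, Finset.sum_const, Finset.card_univ, nsmul_eq_mul]
  simp
  ring

end Construction

section Numerics

/-- With about `B / 64` blocks, a single failure costs more than the target regret. -/
lemma target_le_failure {B L : ℕ} (hB : 1 ≤ B) (hL : 0 < L)
    (hT : (2 : ℝ) ^ (-49 : ℤ) * (2 ^ (B + 1)) ^ 2 * (B + 1) ≤ B * L) :
    (2 : ℝ) ^ (-28 : ℤ) * √(B * L * (B + 1)) ≤ L / 2 ^ (9 * (B / 64 + 1) + 8) := by
  have hL1 : (1 : ℝ) ≤ L := by exact_mod_cast hL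
  have hBpos : (1 : ℝ) ≤ B := by exact_mod_cast hB
  have hsq : (L : ℝ) = √L ^ 2 := (Real.sq_sqrt (by positivity)).symm
  have hS1 : 1 ≤ √(L : ℝ) := Real.one_le_sqrt.mpr hL1
  have hsqrt : √((B : ℝ) * L * (B + 1)) ≤ (B + 1) * √L := by
    refine Real.sqrt_le_iff.mpr ⟨by positivity, ?_⟩
    rw [mul_pow, ← hsq]
    nlinarith
  have hkey : (2 : ℝ) ^ (9 * (B / 64 + 1)) * (B + 1) ≤ 2 ^ 20 * √L := by
    rcases lt_or_ge B 64 with hlt | hge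
    · have hb : B / 64 = 0 := Nat.div_eq_of_lt hlt
      have hB64 : (B : ℝ) + 1 ≤ 64 := by exact_mod_cast hlt
      rw [hb]
      norm_num
      linarith
    · have hroot : (2 : ℝ) ^ (B - 24) ≤ √L := by
        refine Real.le_sqrt_of_sq_le ?_
        have h1 : ((2 : ℝ) ^ (B - 24)) ^ 2 = (2 : ℝ) ^ (-49 : ℤ) * (2 ^ (B + 1)) ^ 2 / 2 := by
          obtain ⟨d, rfl⟩ := Nat.exists_eq_add_of_le (show 24 ≤ B by omega)
          rw [show 24 + d - 24 = d by omega, show 24 + d + 1 = d + 25 by omega, pow_add]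
          norm_num
          ring
        have h2 : (2 : ℝ) ^ (-49 : ℤ) * (2 ^ (B + 1)) ^ 2 * (B + 1) ≤ L * (B + 1) := by
          nlinarith
        have h3 := le_of_mul_le_mul_right h2 (by positivity)
        have h4 : (0 : ℝ) ≤ (2 : ℝ) ^ (-49 : ℤ) * (2 ^ (B + 1)) ^ 2 := by positivity
        rw [h1]
        exact (half_le_self h4).trans h3
      have hexp : B + 1 ≤ 2 ^ (B - 4 - 9 * (B / 64 + 1)) := by
        have h1 := Nat.lt_two_pow_self (n := B - 4 - 9 * (B / 64 + 1) - 2)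
        have h2 : 2 ^ (B - 4 - 9 * (B / 64 + 1)) =
            4 * 2 ^ (B - 4 - 9 * (B / 64 + 1) - 2) := by
          rw [show (4 : ℕ) = 2 ^ 2 by norm_num, ← pow_add]
          congr 1
          omega
        rw [h2]
        omega
      calc (2 : ℝ) ^ (9 * (B / 64 + 1)) * (B + 1)
          ≤ 2 ^ (9 * (B / 64 + 1)) * 2 ^ (B - 4 - 9 * (B / 64 + 1)) := by
            gcongr
            exact_mod_cast hexp
        _ = 2 ^ 20 * 2 ^ (B - 24) := by
            rw [← pow_add, ← pow_add]
            congr 1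
            omega
        _ ≤ _ := by gcongr
  rw [le_div_iff₀ (by positivity), pow_add]
  calc (2 : ℝ) ^ (-28 : ℤ) * √(B * L * (B + 1)) * (2 ^ (9 * (B / 64 + 1)) * 2 ^ 8)
      ≤ (2 : ℝ) ^ (-28 : ℤ) * ((B + 1) * √L) * (2 ^ (9 * (B / 64 + 1)) * 2 ^ 8) := by gcongr
    _ = (2 : ℝ) ^ (-28 : ℤ) * 2 ^ 8 * √L * (2 ^ (9 * (B / 64 + 1)) * (B + 1)) := by ring
    _ ≤ (2 : ℝ) ^ (-28 : ℤ) * 2 ^ 8 * √L * (2 ^ 20 * √L) := by gcongr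
    _ = √L ^ 2 := by
        generalize √(L : ℝ) = s
        norm_num
        ring
    _ = L := hsq.symm

lemma target_le_imitation (B L : ℕ) :
    (2 : ℝ) ^ (-28 : ℤ) * √(B * L * (B + 1)) ≤ ((B / 64 + 1 : ℕ) : ℝ) * √L / 32 := by
  have hsqrt : √((B : ℝ) * L * (B + 1)) ≤ (B + 1) * √L := by
    refine Real.sqrt_le_iff.mpr ⟨by positivity, ?_⟩
    rw [mul_pow, Real.sq_sqrt (by positivity)]
    nlinarith [mul_nonneg (Nat.cast_nonneg (α := ℝ) L) (Nat.cast_nonneg (α := ℝ) B),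
      Nat.cast_nonneg (α := ℝ) L]
  have hm : (B : ℝ) + 1 ≤ 64 * ((B / 64 + 1 : ℕ) : ℝ) := by
    have h : B + 1 ≤ 64 * (B / 64 + 1) := by omega
    exact_mod_cast h
  calc (2 : ℝ) ^ (-28 : ℤ) * √(B * L * (B + 1))
      ≤ (2 : ℝ) ^ (-28 : ℤ) * (64 * ((B / 64 + 1 : ℕ) : ℝ) * √L) := by
        gcongr
        exact hsqrt.trans (by gcongr)
    _ = (((B / 64 + 1 : ℕ) : ℝ) * √L) * (64 * 2 ^ (-28 : ℤ)) := by ring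
    _ ≤ (((B / 64 + 1 : ℕ) : ℝ) * √L) * (1 / 32) := by
        gcongr
        norm_num
    _ = _ := by ring

end Numerics

/-- Lower bound on untruthful swap regret: with two actions, `|Θ| = 2^(B+1)` types,
the uniform prior, and `T` a positive multiple of `B` with `T ≥ 2^(−49)·|Θ|²·log₂|Θ|`,
every deterministic algorithm suffers untruthful swap regret at least
`2^(−28)·√(T·log₂|Θ|)` against some reward sequence. -/
theorem untruthfulSwapRegret_lower_bound
    (B : ℕ) (hB : 1 ≤ B)
    (hA : Fintype.card A = 2)
    (hΘ : Fintype.card Θ = 2 ^ (B + 1))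
    (T : ℕ) (hTpos : 0 < T) (hTmul : B ∣ T)
    (hT : (2 : ℝ) ^ (-49 : ℤ) * (Fintype.card Θ : ℝ) ^ 2 *
        Real.logb 2 (Fintype.card Θ) ≤ (T : ℝ))
    (F : (t : Fin T) → (Fin (t : ℕ) → Θ → A → ℝ) → (Θ → A → ℝ))
    (hF : ∀ t h θ, IsDist (F t h θ)) :
    ∃ u : Fin T → Θ → A → ℝ,
      (∀ t θ a, u t θ a ∈ Set.Icc (0 : ℝ) 1) ∧
      (2 : ℝ) ^ (-28 : ℤ) * Real.sqrt ((T : ℝ) * Real.logb 2 (Fintype.card Θ)) ≤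
        untruthfulSwapRegret (fun _ : Θ => ((Fintype.card Θ : ℝ))⁻¹) T
          (fun t => F t (fun s => u (Fin.castLE t.isLt.le s))) u := by
  have hlog : Real.logb 2 (Fintype.card Θ) = (B : ℝ) + 1 := by
    rw [hΘ, Nat.cast_pow, Nat.cast_ofNat, Real.logb_pow, Real.logb_self_eq_one (by norm_num)]
    push_cast
    ring
  have hcard : (Fintype.card Θ : ℝ) = 2 ^ (B + 1) := by
    rw [hΘ]
    push_cast
    rfl
  obtain ⟨L, hTL⟩ := hTmul
  have hL : 0 < L := Nat.pos_of_ne_zero fun h => by simp [h] at hTL; omega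
  have hTreal : (T : ℝ) = B * L := by
    rw [hTL]
    push_cast
    rfl
  rw [hlog, hcard, hTreal] at hT
  rw [hlog, hcard, hTreal]
  obtain ⟨m, hm⟩ : ∃ m, m = B / 64 + 1 := ⟨_, rfl⟩
  have hmB : m ≤ B := by omega
  have hmL : m * L ≤ T := hTL ▸ Nat.mul_le_mul_right L hmB
  let Y := Fin (B - m) → Bool
  have hY : (Fintype.card Y : ℝ) = 2 ^ (B - m) := by simp [Y]
  have hpow : (2 : ℝ) ^ (B + 1) = 2 * 2 ^ m * 2 ^ (B - m) := by
    rw [← pow_succ', ← pow_add]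
    congr 1
    omega
  let eA : A ≃ Bool := Fintype.equivOfCardEq (by simp [hA])
  let eΘ : Θ ≃ Bool × (Fin m → Bool) × Y := Fintype.equivOfCardEq (by
    rw [hΘ]
    simp only [Y, Fintype.card_prod, Fintype.card_bool, Fintype.card_pi, Finset.prod_const,
      Finset.card_univ, Fintype.card_fin]
    rw [← pow_add, ← pow_succ']
    congr 1
    omega)
  let play : ℕ → (Fin T → Bool) → Fin T → Θ → A → ℝ := fun k σ t =>
    F t (fun s => blockReward eA eΘ L k σ (Fin.castLE t.isLt.le s))
  have hplay : ∀ k σ t θ, IsDist (play k σ t θ) := fun k σ t θ => hF _ _ _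
  have hpred : ∀ t σ σ', (∀ s < t, σ s = σ' s) → play m σ t = play m σ' t := by
    intro t σ σ' h
    simp only [play]
    congr 1
    funext s θ a
    simp only [blockReward, h (Fin.castLE t.isLt.le s) s.isLt]
  have htrunc : ∀ k < m, ∀ σ, ∀ t ∈ block T L k, play (k + 1) σ t = play m σ t := by
    intro k hk σ t ht
    simp only [play]
    congr 1
    funext s θ a
    have h1 : (s : ℕ) / L ≤ k :=
      (Nat.div_le_div_right s.isLt.le).trans (Finset.mem_filter.mp ht).2.le
    simp only [blockReward, Fin.val_castLE, if_pos (Nat.lt_succ_of_le h1), if_pos (h1.trans_lt hk)]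
  by_cases hfail : ∃ σ x, ∃ k < m,
      (L : ℝ) / 64 < ∑ t ∈ block T L k, followError eA eΘ (play m σ t) x k
  · obtain ⟨σ, x, k, hk, hdev⟩ := hfail
    refine ⟨blockReward eA eΘ L (k + 1) σ, blockReward_mem_Icc eA eΘ L hk σ, ?_⟩
    refine le_trans ?_ (le_regret_of_followError eA eΘ hL hk hmL (by positivity)
      (hplay (k + 1) σ) σ x ?_)
    · refine (target_le_failure hB hL hT).trans (le_of_eq ?_)
      rw [← hm, hY, hpow, pow_add, pow_mul, show (2 : ℝ) ^ 9 = 2 * 256 by norm_num, mul_pow]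
      field_simp
      norm_num
    · rw [Finset.sum_congr rfl fun t ht => by rw [htrunc k hk σ t ht]]
      exact hdev.le
  · push Not at hfail
    obtain ⟨σ, x, hgain⟩ := exists_large_gain hL hmL
      (fun x t σ => followError eA eΘ (play m σ t) x (t / L))
      (fun t σ => if (t : ℕ) / L < m then guessBias eA eΘ (play m σ t) else 0)
      (fun x t σ σ' h => by simp only [hpred t σ σ' h])
      (fun t σ σ' h => by simp only [hpred t σ σ' h])
      (fun x t σ => followError_nonneg eA eΘ (hplay m σ t) x _)
      (fun x t σ => followError_le_one eA eΘ (hplay m σ t) x _)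
      (fun σ x j hj => by
        rw [Finset.sum_congr rfl fun t ht => by rw [(Finset.mem_filter.mp ht).2]]
        exact hfail σ x j hj)
    refine ⟨blockReward eA eΘ L m σ, blockReward_mem_Icc eA eΘ L le_rfl σ, ?_⟩
    refine le_trans ?_ (le_regret_of_imitation eA eΘ L _ (hplay m σ) σ x)
    calc _ ≤ (m : ℝ) * √L / 32 := by
          rw [hm]
          exact target_le_imitation B L
      _ = (2 ^ (B + 1))⁻¹ * (2 ^ m * Fintype.card Y * (m * √L / 16)) := by
          rw [hY, hpow]
          field_simp
          ring
      _ ≤ _ := by gcongr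
end
end

section
/- Suppose the Bayesian game satisfies Assumptions 1 and 2. Fix a player i ∈ N and, for each θ ∈ Θ and a_i ∈ A_i, an action a*_{i,θ,a_i} ∈ A_i. Then for every type-wise distribution π that is a communication equilibrium with strategy representability: E_{θ∼ρ} E_{a∼π(θ)}[v_i(θ_i; a)] ≥ E_{θ∼ρ} E_{θ'∼ρ} E_{a∼π(θ')}[v_i(θ_i; a*_{i,θ,a_i}, a_{-i})]. -/
open Finset
open scoped Classical

noncomputable section

variable {ι : Type*} [Fintype ι] [Nonempty ι]
  {Θ A : ι → Type*}
  [∀ i, Fintype (Θ i)] [∀ i, Nonempty (Θ i)]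
  [∀ i, Fintype (A i)] [∀ i, Nonempty (A i)]

/-- The map `η : Δ(S) → Δ(A)^Θ` : `η(σ)(θ;a) = ∑_{s : s(θ) = a} σ(s)`. -/
def eta (σ : ((i : ι) → Θ i → A i) → ℝ) :
    ((i : ι) → Θ i) → ((i : ι) → A i) → ℝ :=
  fun θ a => ∑ s : (i : ι) → Θ i → A i, if (fun i => s i (θ i)) = a then σ s else 0

/-- `π` is strategy-representable if it is realized by a distribution over strategy profiles. -/
def StrategyRepresentable (π : ((i : ι) → Θ i) → ((i : ι) → A i) → ℝ) : Prop :=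
  ∃ σ : ((i : ι) → Θ i → A i) → ℝ, IsDist σ ∧ eta σ = π

/-- Communication equilibrium (exact incentive constraints). -/
def IsCommEq (ρ : ((i : ι) → Θ i) → ℝ)
    (v : (i : ι) → ((j : ι) → Θ j) → ((j : ι) → A j) → ℝ)
    (π : ((i : ι) → Θ i) → ((i : ι) → A i) → ℝ) : Prop :=
  ∀ (i : ι) (ψ : Θ i → Θ i) (φ : Θ i → A i → A i),
    ∑ θ, ρ θ * ∑ a : (j : ι) → A j, π θ a * v i θ a ≥
      ∑ θ, ρ θ * ∑ a : (j : ι) → A j,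
        π (Function.update θ i (ψ (θ i))) a *
          v i θ (Function.update a i (φ (θ i) (a i)))

/-- A product of distributions has total mass one. -/
theorem sum_prod_eq_one_of_isDist {κ : Type*} [Fintype κ] {T : κ → Type*}
    [∀ i, Fintype (T i)] (p : (i : κ) → T i → ℝ) (hp : ∀ i, IsDist (p i)) :
    ∑ θ : (i : κ) → T i, ∏ j, p j (θ j) = 1 := by
  rw [← Fintype.prod_sum]
  exact Finset.prod_eq_one fun i _ => (hp i).2

/-- Exchanging the `i`-th coordinates of two profiles preserves the product of their
weights under a product weight. -/
theorem prod_update_mul_prod_update {κ : Type*} [Fintype κ] {T : κ → Type*}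
    (p : (i : κ) → T i → ℝ) (i : κ)
    (θ τ : (j : κ) → T j) :
    (∏ j, p j (Function.update θ i (τ i) j)) * ∏ j, p j (Function.update τ i (θ i) j) =
      (∏ j, p j (θ j)) * ∏ j, p j (τ j) := by
  rw [← Finset.prod_mul_distrib, ← Finset.prod_mul_distrib]
  refine Finset.prod_congr rfl fun j _ => ?_
  by_cases h : j = i
  · subst h
    simp [mul_comm]
  · simp [h]

/-- Two independent draws from a product weight may exchange their `i`-th coordinates. -/
theorem sum_sum_update_update {κ : Type*} [Fintype κ] {T : κ → Type*}
    [∀ i, Fintype (T i)] (p : (i : κ) → T i → ℝ) (i : κ)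
    (F : ((j : κ) → T j) → ((j : κ) → T j) → ℝ) :
    ∑ τ : (j : κ) → T j, ∑ θ : (j : κ) → T j, (∏ j, p j (θ j)) * (∏ j, p j (τ j)) *
        F (Function.update θ i (τ i)) (Function.update τ i (θ i)) =
      ∑ τ : (j : κ) → T j, ∑ θ : (j : κ) → T j,
        (∏ j, p j (θ j)) * (∏ j, p j (τ j)) * F θ τ := by
  rw [← Fintype.sum_prod_type', ← Fintype.sum_prod_type']
  have hinv : Function.Involutive fun x : ((j : κ) → T j) × ((j : κ) → T j) =>
      (Function.update x.1 i (x.2 i), Function.update x.2 i (x.1 i)) := by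
    intro x
    simp
  refine Fintype.sum_equiv hinv.toPerm _ _ fun x => ?_
  simp only [Function.Involutive.coe_toPerm]
  rw [prod_update_mul_prod_update]

/-- Key lemma for price-of-anarchy bounds: under independent types (Assumption 1) and
private values (Assumption 2), in a communication equilibrium with strategy
representability, each player's equilibrium payoff dominates the payoff of deviating to
`a*_{i,θ,a_i}` against a resampled equilibrium outcome. -/
theorem poa_key_lemma
    (ρi : (i : ι) → Θ i → ℝ) (hρi : ∀ i, IsDist (ρi i))
    (v : (i : ι) → ((j : ι) → Θ j) → ((j : ι) → A j) → ℝ)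
    (hv : ∀ i θ a, v i θ a ∈ Set.Icc (0 : ℝ) 1)
    (h2 : ∀ (i : ι) (θ θ' : (j : ι) → Θ j) (a : (j : ι) → A j),
      θ i = θ' i → v i θ a = v i θ' a)
    (π : ((i : ι) → Θ i) → ((i : ι) → A i) → ℝ)
    (hπ : ∀ θ, IsDist (π θ))
    (hSR : StrategyRepresentable π)
    (hComm : IsCommEq (fun θ => ∏ j, ρi j (θ j)) v π)
    (i : ι)
    (astar : ((j : ι) → Θ j) → A i → A i) :
    ∑ θ, (∏ j, ρi j (θ j)) * ∑ a : (j : ι) → A j, π θ a * v i θ a ≥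
      ∑ θ, (∏ j, ρi j (θ j)) * ∑ θ' : (j : ι) → Θ j, (∏ j, ρi j (θ' j)) *
        ∑ a : (j : ι) → A j, π θ' a * v i θ (Function.update a i (astar θ (a i))) := by
  have hdev (τ : (j : ι) → Θ j) :
      ∑ θ, (∏ j, ρi j (θ j)) * (∏ j, ρi j (τ j)) * ∑ a : (j : ι) → A j,
        π (Function.update θ i (τ i)) a * v i (Function.update τ i (θ i))
          (Function.update a i (astar (Function.update τ i (θ i)) (a i))) ≤
      (∏ j, ρi j (τ j)) *
        ∑ θ, (∏ j, ρi j (θ j)) * ∑ a : (j : ι) → A j, π θ a * v i θ a := by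
    have h := mul_le_mul_of_nonneg_left
      (hComm i (fun _ => τ i) fun x b => astar (Function.update τ i x) b)
      (Finset.prod_nonneg fun j (_ : j ∈ Finset.univ) => ((hρi j).1 (τ j)).1)
    refine le_trans (le_of_eq ?_) h
    rw [Finset.mul_sum]
    refine Finset.sum_congr rfl fun θ _ => ?_
    rw [mul_comm (∏ j, ρi j (θ j)), mul_assoc]
    congr 2
    refine Finset.sum_congr rfl fun a _ => ?_
    rw [h2 i (Function.update τ i (θ i)) θ _ (by simp)]
  have hsum := Finset.sum_le_sum fun τ (_ : τ ∈ Finset.univ) => hdev τ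
  rw [sum_sum_update_update ρi i fun θ τ => ∑ a : (j : ι) → A j,
      π θ a * v i τ (Function.update a i (astar τ (a i))),
    ← Finset.sum_mul, sum_prod_eq_one_of_isDist ρi hρi, one_mul] at hsum
  refine le_trans (le_of_eq ?_) hsum
  refine Finset.sum_congr rfl fun τ _ => ?_
  rw [Finset.mul_sum]
  refine Finset.sum_congr rfl fun θ _ => ?_
  ring
end
end

section
/- Suppose the Bayesian game satisfies Assumptions 1 and 2, the social welfare is the sum of payoffs v_SW(θ;a) = ∑_{i∈N} v_i(θ_i; a), and the game is (λ,μ)-conditionally smooth with λ ≥ 0 and μ ≥ 0. Then for every type-wise distribution π that is a communication equilibrium with strategy representability: E_{θ∼ρ} E_{a∼π(θ)}[v_SW(θ; a)] ≥ (λ/(1+μ)) · E_{θ∼ρ}[ max_{a∈A} v_SW(θ; a) ]. In particular, the price of anarchy over communication equilibria with strategy representability is at least λ/(1+μ). -/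
open Finset
open scoped Classical

noncomputable section

variable {ι : Type*} [Fintype ι] [Nonempty ι]
  {Θ A : ι → Type*}
  [∀ i, Fintype (Θ i)] [∀ i, Nonempty (Θ i)]
  [∀ i, Fintype (A i)] [∀ i, Nonempty (A i)]

/-- For a product weight, exchanging all coordinates but the `i`-th between two independent
profiles leaves the weighted double sum unchanged. -/
theorem sum_prod_exchange {ι : Type*} [Fintype ι] {Θ : ι → Type*} [∀ i, Fintype (Θ i)]
    (w : (i : ι) → Θ i → ℝ) (i : ι) (F : ((j : ι) → Θ j) → ((j : ι) → Θ j) → ℝ) :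
    ∑ t, (∏ j, w j (t j)) * ∑ θ, (∏ j, w j (θ j)) *
        F (Function.update t i (θ i)) (Function.update θ i (t i)) =
      ∑ t, (∏ j, w j (t j)) * ∑ θ, (∏ j, w j (θ j)) * F θ t := by
  simp only [Finset.mul_sum]
  rw [← Fintype.sum_prod_type', ← Fintype.sum_prod_type']
  let e : ((j : ι) → Θ j) × ((j : ι) → Θ j) → ((j : ι) → Θ j) × ((j : ι) → Θ j) :=
    fun x => (Function.update x.2 i (x.1 i), Function.update x.1 i (x.2 i))
  have he : Function.Involutive e := by
    intro x
    simp [e]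
  refine Fintype.sum_equiv he.toPerm _ _ fun x => ?_
  have hw : (∏ j, w j (x.1 j)) * ∏ j, w j (x.2 j) =
      (∏ j, w j ((e x).1 j)) * ∏ j, w j ((e x).2 j) := by
    rw [← Finset.prod_mul_distrib, ← Finset.prod_mul_distrib]
    refine Finset.prod_congr rfl fun j _ => ?_
    by_cases hj : j = i
    · subst hj
      simp [e]
    · simp [e, hj, mul_comm]
  change _ = (∏ j, w j ((e x).1 j)) * ((∏ j, w j ((e x).2 j)) * F (e x).2 (e x).1)
  rw [← mul_assoc, ← mul_assoc, hw]

theorem sum_prod_eq_one {ι : Type*} [Fintype ι] {Θ : ι → Type*} [∀ i, Fintype (Θ i)]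
    {w : (i : ι) → Θ i → ℝ} (hw : ∀ i, IsDist (w i)) :
    ∑ θ : (i : ι) → Θ i, ∏ j, w j (θ j) = 1 := by
  rw [← Fintype.prod_sum]
  exact Finset.prod_eq_one fun j _ => (hw j).2

/-- In a communication equilibrium of a game with independent types and private values, player
`i` cannot gain by deviating through a sampled type profile: the recommended profile is drawn
independently of the true types `θ`, and player `i` replaces the recommendation by `f θ`. -/
theorem IsCommEq.sum_deviation_le {w : (i : ι) → Θ i → ℝ} (hw : ∀ i, IsDist (w i))
    {v : (i : ι) → ((j : ι) → Θ j) → ((j : ι) → A j) → ℝ}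
    (hv : ∀ (i : ι) (θ θ' : (j : ι) → Θ j) (a : (j : ι) → A j),
      θ i = θ' i → v i θ a = v i θ' a)
    {π : ((i : ι) → Θ i) → ((i : ι) → A i) → ℝ}
    (h : IsCommEq (fun θ => ∏ j, w j (θ j)) v π)
    (i : ι) (f : ((j : ι) → Θ j) → A i → A i) :
    ∑ t, (∏ j, w j (t j)) * ∑ θ, (∏ j, w j (θ j)) *
        ∑ a : (j : ι) → A j, π t a * v i θ (Function.update a i (f θ (a i))) ≤
      ∑ θ, (∏ j, w j (θ j)) * ∑ a : (j : ι) → A j, π θ a * v i θ a := by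
  rw [← sum_prod_exchange w i fun θ t =>
    ∑ a : (j : ι) → A j, π t a * v i θ (Function.update a i (f θ (a i)))]
  have hdev : ∀ t : (j : ι) → Θ j, ∑ θ, (∏ j, w j (θ j)) *
      ∑ a : (j : ι) → A j, π (Function.update θ i (t i)) a * v i (Function.update t i (θ i))
        (Function.update a i (f (Function.update t i (θ i)) (a i))) ≤
      ∑ θ, (∏ j, w j (θ j)) * ∑ a : (j : ι) → A j, π θ a * v i θ a := by
    intro t
    refine le_of_eq_of_le ?_ (h i (fun _ => t i) fun θi => f (Function.update t i θi))
    refine Finset.sum_congr rfl fun θ _ => congrArg _ <| Finset.sum_congr rfl fun a _ => ?_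
    rw [hv i (Function.update t i (θ i)) θ _ (by simp)]
  calc _ ≤ ∑ t, (∏ j, w j (t j)) *
        ∑ θ, (∏ j, w j (θ j)) * ∑ a : (j : ι) → A j, π θ a * v i θ a :=
        Finset.sum_le_sum fun t _ => mul_le_mul_of_nonneg_left (hdev t)
          (Finset.prod_nonneg fun j _ => ((hw j).1 _).1)
    _ = _ := by rw [← Finset.sum_mul, sum_prod_eq_one hw, one_mul]

/-- Price-of-anarchy bound for (λ,μ)-conditionally smooth Bayesian games, with social
welfare equal to the sum of payoffs, over communication equilibria with strategy
representability. -/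
theorem poa_conditionally_smooth
    (ρi : (i : ι) → Θ i → ℝ) (hρi : ∀ i, IsDist (ρi i))
    (v : (i : ι) → ((j : ι) → Θ j) → ((j : ι) → A j) → ℝ)
    (hv : ∀ i θ a, v i θ a ∈ Set.Icc (0 : ℝ) 1)
    (h2 : ∀ (i : ι) (θ θ' : (j : ι) → Θ j) (a : (j : ι) → A j),
      θ i = θ' i → v i θ a = v i θ' a)
    (lam mu : ℝ) (hlam : 0 ≤ lam) (hmu : 0 ≤ mu)
    (hsmooth : ∃ astar : (i : ι) → ((j : ι) → Θ j) → A i → A i,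
      ∀ (θ : (j : ι) → Θ j) (a : (j : ι) → A j),
        ∑ i, v i θ (Function.update a i (astar i θ (a i))) ≥
          lam * (⨆ a' : (j : ι) → A j, ∑ i, v i θ a') - mu * ∑ i, v i θ a)
    (π : ((i : ι) → Θ i) → ((i : ι) → A i) → ℝ)
    (hπ : ∀ θ, IsDist (π θ))
    (hSR : StrategyRepresentable π)
    (hComm : IsCommEq (fun θ => ∏ j, ρi j (θ j)) v π) :
    ∑ θ, (∏ j, ρi j (θ j)) * ∑ a : (j : ι) → A j, π θ a * (∑ i, v i θ a) ≥
      (lam / (1 + mu)) *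
        ∑ θ, (∏ j, ρi j (θ j)) * (⨆ a : (j : ι) → A j, ∑ i, v i θ a) := by
  obtain ⟨astar, hs⟩ := hsmooth
  set p : ((j : ι) → Θ j) → ℝ := fun θ => ∏ j, ρi j (θ j) with hp
  have hp0 : ∀ θ, 0 ≤ p θ := fun θ => Finset.prod_nonneg fun j _ => ((hρi j).1 _).1
  have hp1 : ∑ θ, p θ = 1 := sum_prod_eq_one hρi
  set opt : ((j : ι) → Θ j) → ℝ := fun θ => ⨆ a : (j : ι) → A j, ∑ i, v i θ a
  set W : ℝ := ∑ θ, p θ * ∑ a : (j : ι) → A j, π θ a * ∑ i, v i θ a with hW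
  have hWsum : W = ∑ i, ∑ θ, p θ * ∑ a : (j : ι) → A j, π θ a * v i θ a := by
    simp only [hW, Finset.mul_sum]
    refine Eq.trans (Finset.sum_congr rfl fun θ _ => ?_) Finset.sum_comm
    exact Finset.sum_comm
  have hsum : ∀ g : (i : ι) → ((j : ι) → Θ j) → A i → A i,
      ∑ t, p t * ∑ θ, p θ * ∑ a : (j : ι) → A j,
        π t a * ∑ i, v i θ (Function.update a i (g i θ (a i))) ≤ W := by
    intro g
    rw [hWsum]
    refine le_of_eq_of_le ?_ (Finset.sum_le_sum fun i _ => hComm.sum_deviation_le hρi h2 i (g i))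
    simp only [Finset.mul_sum, hp]
    refine Eq.trans (Finset.sum_congr rfl fun t _ => ?_) Finset.sum_comm
    refine Eq.trans (Finset.sum_congr rfl fun θ _ => ?_) Finset.sum_comm
    exact Finset.sum_comm
  have hobey := hsum fun _ _ x => x
  simp only [Function.update_eq_self] at hobey
  have hlow : lam * ∑ θ, p θ * opt θ - mu * ∑ t, p t * ∑ θ, p θ *
      ∑ a : (j : ι) → A j, π t a * ∑ i, v i θ a ≤ W := by
    have hpt : ∀ t θ, lam * opt θ - mu * ∑ a : (j : ι) → A j, π t a * ∑ i, v i θ a ≤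
        ∑ a : (j : ι) → A j, π t a * ∑ i, v i θ (Function.update a i (astar i θ (a i))) := by
      intro t θ
      calc _ = ∑ a : (j : ι) → A j, π t a * (lam * opt θ - mu * ∑ i, v i θ a) := by
            simp only [mul_sub, Finset.sum_sub_distrib, ← Finset.sum_mul, (hπ t).2, one_mul,
              mul_left_comm _ mu, ← Finset.mul_sum]
        _ ≤ _ := Finset.sum_le_sum fun a _ =>
            mul_le_mul_of_nonneg_left (hs θ a) ((hπ t).1 a).1
    calc _ = ∑ t, p t * ∑ θ, p θ *
          (lam * opt θ - mu * ∑ a : (j : ι) → A j, π t a * ∑ i, v i θ a) := by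
          simp only [mul_sub, Finset.sum_sub_distrib, ← Finset.sum_mul, hp1, one_mul,
            mul_left_comm _ lam, mul_left_comm _ mu, ← Finset.mul_sum]
      _ ≤ _ := Finset.sum_le_sum fun t _ => mul_le_mul_of_nonneg_left
          (Finset.sum_le_sum fun θ _ => mul_le_mul_of_nonneg_left (hpt t θ) (hp0 θ)) (hp0 t)
      _ ≤ W := hsum astar
  have hmul := mul_le_mul_of_nonneg_left hobey hmu
  rw [ge_iff_le, div_mul_eq_mul_div, div_le_iff₀ (by linarith)]
  linarith
end
end
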